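/- arXiv:2005.12038 — 12 statements merged into one kernel-verified Lean document; each statement's English description precedes it below -/
import Mathlib

section
/- Let N ≥ 1 and let u(N) denote the real vector space of skew-adjoint complex N×N matrices {X ∈ M_N(ℂ) : Xᴴ = −X}, equipped with the real inner product ⟨X,Y⟩ = N·Re(Tr(Xᴴ·Y)). If (H_1, …, H_{N²}) is any orthonormal basis of this real inner product space, then for every X ∈ M_N(ℂ) one has ∑_{a=1}^{N²} H_a · X · H_a = −(1/N)·Tr(X)·I_N; in particular ∑_{a=1}^{N²} H_a² = −I_N. -/
open Matrix

/-- The trace of a product of two skew-adjoint matrices is real. -/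
theorem im_trace_mul_eq_zero_of_conjTranspose_eq_neg {n : Type*} [Fintype n]
    {A B : Matrix n n ℂ} (hA : Aᴴ = -A) (hB : Bᴴ = -B) : ((A * B).trace).im = 0 := by
  have h : star (A * B).trace = (A * B).trace := by
    rw [← trace_conjTranspose, conjTranspose_mul, hA, hB, neg_mul_neg, trace_mul_comm]
  exact Complex.conj_eq_iff_im.mp h

/-- If the skew-adjoint matrices satisfy a trace expansion, so do all complex matrices. -/
theorem eq_sum_trace_smul_of_forall_skewAdjoint {n ι : Type*} [Fintype n] [Fintype ι]
    (c : ℂ) (H : ι → Matrix n n ℂ)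
    (h : ∀ X : Matrix n n ℂ, Xᴴ = -X → ∑ a, (c * (H a * X).trace) • H a = X)
    (X : Matrix n n ℂ) : ∑ a, (c * (H a * X).trace) • H a = X := by
  have h₁ := h ((1 / 2 : ℂ) • (X - Xᴴ)) (by
    simp [conjTranspose_smul, ← smul_neg])
  have h₂ := h ((Complex.I / 2 : ℂ) • (X + Xᴴ)) (by
    simp [conjTranspose_smul, neg_div, add_comm])
  have hX : X = (1 / 2 : ℂ) • (X - Xᴴ) + (-Complex.I) • ((Complex.I / 2 : ℂ) • (X + Xᴴ)) := by
    have hI : -Complex.I * (Complex.I / 2) = 1 / 2 := by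
      linear_combination (-1 / 2 : ℂ) * Complex.I_mul_I
    rw [smul_smul, hI]
    module
  conv_rhs => rw [hX, ← h₁, ← h₂]
  rw [Finset.smul_sum, ← Finset.sum_add_distrib]
  refine Finset.sum_congr rfl fun a _ => ?_
  conv_lhs => rw [hX]
  rw [smul_smul (-Complex.I) (c * _) (H a), ← add_smul, mul_add, trace_add,
    mul_smul_comm (-Complex.I), trace_smul, smul_eq_mul]
  congr 1
  ring

/-- A trace expansion with constant `c` determines the superoperator `X ↦ ∑ a, H a * X * H a`
up to `c`. -/
theorem smul_sum_mul_mul_eq_trace_smul_one {n ι : Type*} [Fintype n] [DecidableEq n] [Fintype ι]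
    (c : ℂ) (H : ι → Matrix n n ℂ)
    (h : ∀ X : Matrix n n ℂ, ∑ a, (c * (H a * X).trace) • H a = X) (X : Matrix n n ℂ) :
    c • ∑ a, H a * X * H a = X.trace • (1 : Matrix n n ℂ) := by
  have key (p r s q : n) : ∑ a, c * H a p r * H a s q = if r = s ∧ p = q then 1 else 0 := by
    simpa [Matrix.sum_apply, trace_mul_single, single_apply] using
      congrFun₂ (h (single r p 1)) s q
  ext p q
  calc (c • ∑ a, H a * X * H a) p q
      = ∑ s, ∑ r, X r s * ∑ a, c * H a p r * H a s q := by
        simp only [Matrix.smul_apply, Matrix.sum_apply, mul_apply, Finset.mul_sum, Finset.sum_mul,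
          smul_eq_mul]
        rw [Finset.sum_comm]
        refine Finset.sum_congr rfl fun s _ => ?_
        rw [Finset.sum_comm]
        refine Finset.sum_congr rfl fun r _ => Finset.sum_congr rfl fun a _ => ?_
        ring
    _ = (X.trace • (1 : Matrix n n ℂ)) p q := by
        by_cases hpq : p = q <;> simp [key, hpq, trace]

/-- The Casimir of `u(N,ℂ)`: for any orthonormal basis `(H_a)` of the real inner
product space of skew-adjoint complex `N × N` matrices with inner product
`⟨X,Y⟩ = N·Re(Tr(Xᴴ·Y))`, one has `∑ a, H_a X H_a = -(Tr X / N) • 1`, and in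
particular `∑ a, H_a² = -1`. -/
theorem stmt0 (N : ℕ) (hN : 1 ≤ N)
    (H : Fin (N ^ 2) → Matrix (Fin N) (Fin N) ℂ)
    (hskew : ∀ a, (H a)ᴴ = -H a)
    (horth : ∀ a b, (N : ℝ) * (((H a)ᴴ * H b).trace).re = if a = b then 1 else 0)
    (hspan : ∀ X : Matrix (Fin N) (Fin N) ℂ, Xᴴ = -X →
      X ∈ Submodule.span ℝ (Set.range H)) :
    (∀ X : Matrix (Fin N) (Fin N) ℂ,
      ∑ a, H a * X * H a
        = (-(X.trace / (N : ℂ))) • (1 : Matrix (Fin N) (Fin N) ℂ)) ∧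
    ∑ a, H a * H a = -(1 : Matrix (Fin N) (Fin N) ℂ) := by
  have hN₀ : (N : ℂ) ≠ 0 := Nat.cast_ne_zero.mpr (by omega)
  have gram (a b : Fin (N ^ 2)) : -(N : ℂ) * (H a * H b).trace = if a = b then 1 else 0 := by
    have hre := horth a b
    rw [hskew a, neg_mul, trace_neg, Complex.neg_re] at hre
    have him := im_trace_mul_eq_zero_of_conjTranspose_eq_neg (hskew a) (hskew b)
    apply Complex.ext
    · split_ifs at hre ⊢ <;> simpa using hre
    · split_ifs <;> simp [him]
  have skew_expansion (X : Matrix (Fin N) (Fin N) ℂ) (hX : Xᴴ = -X) :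
      ∑ a, (-(N : ℂ) * (H a * X).trace) • H a = X := by
    have hmem := hspan X hX
    clear hX
    induction hmem using Submodule.span_induction with
    | mem x hx =>
      obtain ⟨b, rfl⟩ := hx
      simp only [gram, ite_smul, one_smul, zero_smul, Finset.sum_ite_eq', Finset.mem_univ, if_true]
    | zero => simp
    | add x y _ _ hx hy =>
      simp only [mul_add, trace_add, add_smul, Finset.sum_add_distrib, hx, hy]
    | smul r x _ hx =>
      conv_rhs => rw [← hx, Finset.smul_sum]
      refine Finset.sum_congr rfl fun a _ => ?_
      rw [mul_smul_comm, trace_smul, mul_smul_comm, smul_assoc]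
  have casimir (X : Matrix (Fin N) (Fin N) ℂ) :
      ∑ a, H a * X * H a = (-(X.trace / (N : ℂ))) • (1 : Matrix (Fin N) (Fin N) ℂ) := by
    have h := smul_sum_mul_mul_eq_trace_smul_one (-(N : ℂ)) H
      (eq_sum_trace_smul_of_forall_skewAdjoint _ H skew_expansion) X
    rw [← inv_smul_smul₀ (neg_ne_zero.mpr hN₀) (∑ a, H a * X * H a), h, smul_smul]
    congr 1
    rw [inv_neg]
    ring
  refine ⟨casimir, ?_⟩
  simpa [hN₀] using casimir 1
end

section
/- Let N ≥ 1 and let sp(N) denote the real vector space of skew-adjoint quaternionic N×N matrices {X ∈ M_N(ℍ) : X⋆ = −X}, where X⋆ is the quaternionic conjugate transpose, equipped with the real inner product ⟨X,Y⟩ = 2N·Re(Tr(X⋆·Y)). If (H_1, …, H_{N(2N+1)}) is any orthonormal basis of this real inner product space, then ∑_a H_a² = −((2N+1)/(2N))·I_N. -/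
open Matrix

/-- A spanning family that is orthonormal for a form `B`, linear in its second variable,
expands every vector. -/
lemma sum_smul_eq_of_orthonormal_of_mem_span {ι V : Type*} [Fintype ι] [DecidableEq ι]
    [AddCommGroup V] [Module ℝ V] (B : V → V →ₗ[ℝ] ℝ) (v : ι → V)
    (hv : ∀ a b, B (v a) (v b) = if a = b then 1 else 0) {x : V}
    (hx : x ∈ Submodule.span ℝ (Set.range v)) :
    ∑ a, B (v a) x • v a = x := by
  obtain ⟨c, rfl⟩ := (Submodule.mem_span_range_iff_exists_fun ℝ).1 hx
  simp [map_sum, hv]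

/-- The real bilinear form `(X, Y) ↦ c * Re (Tr (X⋆ * Y))` as a linear form in `Y`. -/
noncomputable def reTraceForm {n : Type*} [Fintype n] (c : ℝ)
    (X : Matrix n n (Quaternion ℝ)) : Matrix n n (Quaternion ℝ) →ₗ[ℝ] ℝ where
  toFun Y := c * ((Xᴴ * Y).trace).re
  map_add' Y Z := by simp [Matrix.trace_add, _root_.mul_add]
  map_smul' r Y := by
    simp [Matrix.mul_smul, Matrix.trace_smul, mul_left_comm]

lemma reTraceForm_single {n : Type*} [Fintype n] [DecidableEq n] (c : ℝ)
    (X : Matrix n n (Quaternion ℝ)) (i k : n) (e : Quaternion ℝ) :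
    reTraceForm c X (single i k e) = c * (star (X i k) * e).re := by
  simp [reTraceForm, Matrix.trace_mul_single]

lemma reTraceForm_single_sub_single {n : Type*} [Fintype n] [DecidableEq n] (c : ℝ)
    {X : Matrix n n (Quaternion ℝ)} (hX : Xᴴ = -X) (i k : n) (e : Quaternion ℝ) :
    reTraceForm c X (single i k e - single k i (star e))
      = 2 * c * (star (X i k) * e).re := by
  have h : star (X k i) = -X i k := congrFun (congrFun hX i) k
  rw [map_sub, reTraceForm_single, reTraceForm_single, h]
  simp
  ring

/-- The quaternions `1, i, j, k`. -/
def Quaternion.basisUnit : Fin 4 → Quaternion ℝ :=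
  ![1, ⟨0, 1, 0, 0⟩, ⟨0, 0, 1, 0⟩, ⟨0, 0, 0, 1⟩]

lemma Quaternion.re_basisUnit (u : Fin 4) : (basisUnit u).re = ![1, 0, 0, 0] u := by
  fin_cases u <;> rfl

lemma Quaternion.imI_basisUnit (u : Fin 4) : (basisUnit u).imI = ![0, 1, 0, 0] u := by
  fin_cases u <;> rfl

lemma Quaternion.imJ_basisUnit (u : Fin 4) : (basisUnit u).imJ = ![0, 0, 1, 0] u := by
  fin_cases u <;> rfl

lemma Quaternion.imK_basisUnit (u : Fin 4) : (basisUnit u).imK = ![0, 0, 0, 1] u := by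
  fin_cases u <;> rfl

/-- The expansion of a quaternion in the orthonormal basis `1, i, j, k`. -/
lemma Quaternion.eq_sum_re_star_mul (q : Quaternion ℝ) :
    q = ∑ u, (star q * basisUnit u).re • basisUnit u := by
  ext <;> simp [Fin.sum_univ_four, re_basisUnit, imI_basisUnit, imJ_basisUnit, imK_basisUnit]

lemma Quaternion.sum_basisUnit_mul_self :
    ∑ u, basisUnit u * basisUnit u = (-2 : ℝ) • 1 := by
  ext <;> simp [Fin.sum_univ_four, re_basisUnit, imI_basisUnit, imJ_basisUnit, imK_basisUnit]
  norm_num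

lemma Quaternion.sum_basisUnit_mul_star :
    ∑ u, basisUnit u * star (basisUnit u) = (4 : ℝ) • 1 := by
  ext <;> simp [Fin.sum_univ_four, re_basisUnit, imI_basisUnit, imJ_basisUnit, imK_basisUnit]
  norm_num

/-- The Casimir of `sp(N)`: for any orthonormal basis `(H_a)` of the real inner
product space of skew-adjoint quaternionic `N × N` matrices with inner product
`⟨X,Y⟩ = 2N·Re(Tr(X⋆·Y))`, one has `∑ a, H_a² = -((2N+1)/(2N)) • 1`. -/
theorem stmt2 (N : ℕ) (hN : 1 ≤ N)
    (H : Fin (N * (2 * N + 1)) → Matrix (Fin N) (Fin N) (Quaternion ℝ))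
    (hskew : ∀ a, (H a)ᴴ = -H a)
    (horth : ∀ a b,
      (2 * (N : ℝ)) * (((H a)ᴴ * H b).trace).re = if a = b then 1 else 0)
    (hspan : ∀ X : Matrix (Fin N) (Fin N) (Quaternion ℝ), Xᴴ = -X →
      X ∈ Submodule.span ℝ (Set.range H)) :
    ∑ a, H a * H a
      = (-((2 * (N : ℝ) + 1) / (2 * (N : ℝ))))
          • (1 : Matrix (Fin N) (Fin N) (Quaternion ℝ)) := by
  have hN0 : (N : ℝ) ≠ 0 := by positivity
  have key (i k j : Fin N) (e : Quaternion ℝ) :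
      ∑ a, (star (H a i k) * e).re • H a k j
        = (4 * (N : ℝ))⁻¹ • ((if i = k ∧ k = j then e else 0) - if i = j then star e else 0) := by
    have h := sum_smul_eq_of_orthonormal_of_mem_span (reTraceForm (2 * (N : ℝ))) H horth
      (hspan (single i k e - single k i (star e)) (by simp [conjTranspose_sub]))
    have h' := congrFun (congrFun h k) j
    simp only [reTraceForm_single_sub_single _ (hskew _), Matrix.sum_apply, Matrix.smul_apply,
      Matrix.sub_apply, Matrix.single_apply, mul_smul (2 * (2 * (N : ℝ))),
      true_and, ← Finset.smul_sum] at h'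
    rw [← h', smul_smul, show (4 * (N : ℝ))⁻¹ * (2 * (2 * N)) = 1 by field_simp; norm_num,
      one_smul]
  have entry (i k j : Fin N) :
      ∑ a, H a i k * H a k j = ((4 * (N : ℝ))⁻¹ *
        ((if i = k ∧ k = j then -2 else 0) - if i = j then 4 else 0)) • (1 : Quaternion ℝ) := by
    have h (a) : H a i k * H a k j = _ :=
      congrArg (· * H a k j) (Quaternion.eq_sum_re_star_mul (H a i k))
    simp only [h, Finset.sum_mul, smul_mul_assoc]
    rw [Finset.sum_comm]
    simp only [← mul_smul_comm, ← Finset.mul_sum, key]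
    simp only [mul_smul_comm, ← Finset.smul_sum, mul_smul]
    congr 1
    simp only [_root_.mul_sub, mul_ite, mul_zero, Finset.sum_sub_distrib, sub_smul]
    split_ifs <;>
      simp [Quaternion.sum_basisUnit_mul_self, Quaternion.sum_basisUnit_mul_star]
  ext1 i j
  rw [Matrix.sum_apply]
  simp only [Matrix.mul_apply]
  rw [Finset.sum_comm]
  simp only [entry, ← Finset.sum_smul, ← Finset.mul_sum, Finset.sum_sub_distrib]
  by_cases hij : i = j
  · subst hij
    have h (k : Fin N) : (i = k ∧ k = i) ↔ i = k := by grind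
    simp only [h, Finset.sum_ite_eq, Finset.mem_univ, if_true, Finset.sum_const,
      Finset.card_univ, Fintype.card_fin, Matrix.smul_apply, Matrix.one_apply_eq]
    congr 1
    field_simp
    simp only [nsmul_eq_mul]
    ring
  · have h (k : Fin N) : ¬(i = k ∧ k = j) := by grind
    simp [h, hij]
end

section
/- Let N, k ≥ 1, let σ be a permutation of Fin k, and let A_1, …, A_k ∈ M_N(ℝ). Then ∑_{f : Fin k → Fin N} ∏_{l=1}^{k} (A_l)_{f(σ⁻¹(l)), f(l)} = ∏_{O orbit of σ} Tr(A_{c_O} · A_{σ(c_O)} · A_{σ²(c_O)} ⋯ A_{σ^{|O|−1}(c_O)}), where for each orbit O of σ on Fin k, c_O is any chosen element of O and |O| is its cardinality; by cyclic invariance of the trace the right-hand side does not depend on the choices of representatives c_O. -/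
open Matrix

theorem Matrix.prod_ofFn_apply_eq_sum {ι S : Type*} [Fintype ι] [DecidableEq ι] [CommSemiring S]
    (n : ℕ) (B : Fin (n + 1) → Matrix ι ι S) (a b : ι) :
    (List.ofFn B).prod a b =
      ∑ h : Fin n → ι, ∏ m, B m ((Fin.cons a h : Fin (n + 1) → ι) m)
        ((Fin.snoc h b : Fin (n + 1) → ι) m) := by
  induction n generalizing a with
  | zero => simp [Fin.snoc]
  | succ n ih =>
    rw [List.ofFn_succ, List.prod_cons, Matrix.mul_apply,
      ← (Fin.consEquiv fun _ : Fin (n + 1) => ι).sum_comp, Fintype.sum_prod_type]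
    refine Finset.sum_congr rfl fun c _ => ?_
    rw [ih, Finset.mul_sum]
    refine Finset.sum_congr rfl fun h _ => ?_
    conv_rhs => rw [Fin.prod_univ_succ]
    simp [Fin.consEquiv, ← Fin.cons_snoc_eq_snoc_cons]

theorem Matrix.trace_prod_ofFn {ι S : Type*} [Fintype ι] [DecidableEq ι] [CommSemiring S]
    (n : ℕ) [NeZero n] (B : Fin n → Matrix ι ι S) :
    (List.ofFn B).prod.trace = ∑ h : Fin n → ι, ∏ m, B m (h (m - 1)) (h m) := by
  obtain _ | n := n
  · exact absurd rfl (NeZero.ne 0)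
  · rw [← (Fin.snocEquiv fun _ : Fin (n + 1) => ι).sum_comp, Fintype.sum_prod_type]
    refine Finset.sum_congr rfl fun a _ => ?_
    rw [Matrix.diag_apply, Matrix.prod_ofFn_apply_eq_sum]
    refine Finset.sum_congr rfl fun h _ => Finset.prod_congr rfl fun m _ => ?_
    simp only [Fin.snocEquiv, Equiv.coe_fn_mk]
    congr 1
    induction m using Fin.cases with
    | zero =>
      rw [show (0 - 1 : Fin (n + 1)) = Fin.last n by
        rw [sub_eq_iff_eq_add, Fin.last_add_one]]
      simp
    | succ i =>
      rw [show (i.succ - 1 : Fin (n + 1)) = i.castSucc by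
        rw [sub_eq_iff_eq_add, Fin.coeSucc_eq_succ]]
      simp

theorem Equiv.Perm.ncard_sameCycle {α : Type*} [Finite α] (σ : Equiv.Perm α) (x : α) :
    Set.ncard {y | σ.SameCycle x y} = Function.minimalPeriod σ x := by
  have h : {y | σ.SameCycle x y} = MulAction.orbit (Subgroup.zpowers σ) x := by
    ext y
    simp [Equiv.Perm.SameCycle, MulAction.mem_orbit_iff, Subgroup.exists_zpowers, Subgroup.smul_def]
  rw [h, ← Nat.card_coe_set_eq]
  have := Fintype.ofFinite (MulAction.orbit (Subgroup.zpowers σ) x)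
  rw [Nat.card_eq_fintype_card, ← MulAction.minimalPeriod_eq_card]
  rfl

/-- A transversal of the cycles of `σ` enumerates the whole type by powers of `σ`. -/
theorem Equiv.Perm.bijective_pow_apply_of_transversal {α : Type*} [Finite α] (σ : Equiv.Perm α)
    (R : Finset α) (hR : ∀ x, ∃! r, r ∈ R ∧ σ.SameCycle r x) :
    Function.Bijective fun p : (Σ r : R, Fin (Function.minimalPeriod σ (r : α))) =>
      (σ ^ (p.2 : ℕ)) (p.1 : α) := by
  constructor
  · rintro ⟨r, i⟩ ⟨s, j⟩ h
    dsimp only at h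
    obtain rfl : r = s := Subtype.ext <| (hR ((σ ^ (i : ℕ)) r)).unique
      ⟨r.2, i, by simp⟩ ⟨s.2, j, by simp [h]⟩
    rw [← Equiv.Perm.iterate_eq_pow, ← Equiv.Perm.iterate_eq_pow] at h
    have := (Function.iterate_eq_iterate_iff_of_lt_minimalPeriod i.2 j.2).1 h
    rw [Fin.ext this]
  · intro x
    obtain ⟨r, ⟨hr, hx⟩, -⟩ := hR x
    obtain ⟨i, hi⟩ := hx.exists_nat_pow_eq
    have hpos : 0 < Function.minimalPeriod σ r :=
      Function.minimalPeriod_pos_of_mem_periodicPts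
        (σ.injective.mem_periodicPts r)
    refine ⟨⟨⟨r, hr⟩, ⟨i % Function.minimalPeriod σ r, Nat.mod_lt _ hpos⟩⟩, ?_⟩
    dsimp only
    rw [← hi, ← Equiv.Perm.iterate_eq_pow, ← Equiv.Perm.iterate_eq_pow,
      Function.iterate_mod_minimalPeriod_eq]

theorem Equiv.Perm.inv_apply_pow_apply {α : Type*} (σ : Equiv.Perm α) (x : α)
    [NeZero (Function.minimalPeriod σ x)] (m : Fin (Function.minimalPeriod σ x)) :
    σ⁻¹ ((σ ^ (m : ℕ)) x) = (σ ^ ((m - 1 : Fin (Function.minimalPeriod σ x)) : ℕ)) x := by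
  rw [Equiv.Perm.inv_eq_iff_eq, ← Equiv.Perm.mul_apply, ← pow_succ']
  have h : (m : ℕ) = (((m - 1 : Fin (Function.minimalPeriod σ x)) : ℕ) + 1)
      % Function.minimalPeriod σ x := by
    conv_lhs => rw [← sub_add_cancel m 1]
    rw [Fin.val_add, Fin.val_one', Nat.add_mod_mod]
  conv_lhs => rw [h]
  rw [← Equiv.Perm.iterate_eq_pow, ← Equiv.Perm.iterate_eq_pow,
      Function.iterate_mod_minimalPeriod_eq]

/-- Trace formula for permutation diagrams: for matrices `A_1, …, A_k` and a
permutation `σ` of `Fin k`,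
`∑_{f : Fin k → Fin N} ∏_l (A_l)_{f(σ⁻¹ l), f l}` equals the product, over the
orbits of `σ` (with chosen representatives `r ∈ R`), of
`Tr(A_r ⬝ A_{σ r} ⬝ ⋯ ⬝ A_{σ^{|O|-1} r})`. -/
theorem stmt3 (N k : ℕ) (hN : 1 ≤ N) (hk : 1 ≤ k)
    (σ : Equiv.Perm (Fin k)) (A : Fin k → Matrix (Fin N) (Fin N) ℝ)
    (R : Finset (Fin k))
    (hR : ∀ x : Fin k, ∃! r, r ∈ R ∧ σ.SameCycle r x) :
    (∑ f : Fin k → Fin N, ∏ l : Fin k, A l (f (σ⁻¹ l)) (f l))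
      = ∏ r ∈ R,
          (((List.range (Set.ncard {x | σ.SameCycle r x})).map
              (fun m => A ((σ ^ m) r))).prod).trace := by
  have hne (r : Fin k) : NeZero (Function.minimalPeriod σ r) :=
    ⟨(Function.minimalPeriod_pos_of_mem_periodicPts (σ.injective.mem_periodicPts r)).ne'⟩
  let e := Equiv.ofBijective _ (σ.bijective_pow_apply_of_transversal R hR)
  have he (r : R) (m : Fin (Function.minimalPeriod σ (r : Fin k))) :
      e ⟨r, m⟩ = (σ ^ (m : ℕ)) (r : Fin k) := rfl
  let E : (Fin k → Fin N) ≃ ((r : R) → Fin (Function.minimalPeriod σ (r : Fin k)) → Fin N) :=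
    (e.symm.arrowCongr (Equiv.refl _)).trans (Equiv.piCurry fun _ _ => Fin N)
  have hE (f : Fin k → Fin N) (r : R) (m : Fin (Function.minimalPeriod σ (r : Fin k))) :
      E f r m = f (e ⟨r, m⟩) := rfl
  have htrace (r : Fin k) :
      (((List.range (Set.ncard {x | σ.SameCycle r x})).map
        (fun m => A ((σ ^ m) r))).prod).trace =
      ∑ h : Fin (Function.minimalPeriod σ r) → Fin N,
        ∏ m : Fin (Function.minimalPeriod σ r), A ((σ ^ (m : ℕ)) r) (h (m - 1)) (h m) := by
    rw [σ.ncard_sameCycle, ← Matrix.trace_prod_ofFn _ fun m : Fin (Function.minimalPeriod σ r) => A ((σ ^ (m : ℕ)) r),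
      List.ofFn_eq_map, ← List.map_coe_finRange_eq_range, List.map_map]
    rfl
  simp_rw [htrace]
  rw [← Finset.prod_coe_sort, Finset.prod_univ_sum, Fintype.piFinset_univ, ← E.sum_comp]
  refine Finset.sum_congr rfl fun f _ => ?_
  rw [← e.prod_comp, Fintype.prod_sigma]
  refine Finset.prod_congr rfl fun r _ => Finset.prod_congr rfl fun m _ => ?_
  rw [hE, hE, he, he, σ.inv_apply_pow_apply]
end

section
/- Let N, k ≥ 1, let σ be a permutation of Fin k, S ⊆ Fin k, and A_1, …, A_k ∈ M_N(ℝ). Let b_{σ,S} be the Brauer diagram on V = Fin k × Bool that, for each l ∈ Fin k, pairs the vertex (l, [l ∈ S]) with the vertex (σ(l), ¬[σ(l) ∈ S]) (here [·] ∈ Bool; b_{σ,S} is the twist by S of the permutation diagram of σ). Set B_l = A_l if l ∉ S and B_l = A_lᵀ if l ∈ S. Then ∑_{g} ∏_{l=1}^{k} (A_l)_{g(l,true), g(l,false)} = ∏_{O orbit of σ} Tr(B_{c_O} · B_{σ(c_O)} ⋯ B_{σ^{|O|−1}(c_O)}), where the sum ranges over all functions g : Fin k × Bool → Fin N that are constant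 on each pair of b_{σ,S}, and c_O is any chosen element of the orbit O. -/
open Matrix

namespace Matrix

variable {ι : Type*} [Fintype ι] [DecidableEq ι] {R : Type*} [CommSemiring R]

/-- An entry of a product of `n + 1` matrices as a sum over paths. -/
theorem list_prod_range_apply (n : ℕ) (C : ℕ → Matrix ι ι R) (i j : ι) :
    ((List.range (n + 1)).map C).prod i j =
      ∑ h : Fin n → ι, ∏ m : Fin (n + 1),
        C m (Fin.cons (α := fun _ => ι) i h m) (Fin.snoc (α := fun _ => ι) h j m) := by
  induction n generalizing C i with
  | zero => simp [Fin.snoc]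
  | succ n ih =>
    rw [List.range_succ_eq_map, List.map_cons, List.prod_cons, List.map_map, Matrix.mul_apply,
      ← (Fin.consEquiv fun _ : Fin (n + 1) => ι).sum_comp, Fintype.sum_prod_type]
    refine Finset.sum_congr rfl fun a _ => ?_
    rw [ih, Finset.mul_sum]
    refine Finset.sum_congr rfl fun h _ => ?_
    simp [Fin.consEquiv, Fin.prod_univ_succ (n := n + 1), ← Fin.cons_snoc_eq_snoc_cons]

/-- The trace of a nonempty product of matrices as a sum over closed paths. -/
theorem trace_list_prod_range {n : ℕ} (hn : n ≠ 0) (C : ℕ → Matrix ι ι R) :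
    ((List.range n).map C).prod.trace =
      ∑ h : Fin n → ι, ∏ m : Fin n, C m (h m) (h (finRotate n m)) := by
  obtain ⟨n, rfl⟩ := Nat.exists_eq_succ_of_ne_zero hn
  rw [← (Fin.consEquiv fun _ : Fin (n + 1) => ι).sum_comp, Fintype.sum_prod_type, Matrix.trace]
  refine Finset.sum_congr rfl fun i _ => ?_
  rw [Matrix.diag_apply, list_prod_range_apply]
  refine Finset.sum_congr rfl fun h _ => ?_
  rw [Fin.snoc_eq_cons_rotate]
  rfl

end Matrix

namespace Equiv.Perm

variable {α : Type*}

theorem minimalPeriod_pos [Finite α] (σ : Perm α) (r : α) : 0 < Function.minimalPeriod σ r :=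
  Function.minimalPeriod_pos_of_mem_periodicPts
    (Function.Injective.mem_periodicPts σ.injective r)

theorem SameCycle.exists_pow_lt_minimalPeriod [Finite α] {σ : Perm α} {r x : α} (h : σ.SameCycle r x) :
    ∃ m < Function.minimalPeriod σ r, (σ ^ m) r = x := by
  obtain ⟨m, hm⟩ := h.exists_nat_pow_eq
  refine ⟨m % Function.minimalPeriod σ r, Nat.mod_lt _ (σ.minimalPeriod_pos r), ?_⟩
  rw [← hm, ← iterate_eq_pow, ← iterate_eq_pow, Function.iterate_mod_minimalPeriod_eq]

theorem ncard_sameCycle_s4 [Finite α] (σ : Perm α) (r : α) :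
    Set.ncard {x | σ.SameCycle r x} = Function.minimalPeriod σ r := by
  have hset : {x | σ.SameCycle r x} =
      (fun m => σ^[m] r) '' Set.Iio (Function.minimalPeriod σ r) := by
    ext x
    simp only [Set.mem_ofPred_eq, Set.mem_image, Set.mem_Iio, iterate_eq_pow]
    refine ⟨SameCycle.exists_pow_lt_minimalPeriod, ?_⟩
    rintro ⟨m, -, rfl⟩
    exact ⟨m, by simp⟩
  rw [hset, Set.InjOn.ncard_image Function.iterate_injOn_Iio_minimalPeriod,
    Set.ncard_eq_toFinset_card']
  simp

theorem pow_finRotate_minimalPeriod (σ : Perm α) (r : α)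
    (m : Fin (Function.minimalPeriod σ r)) :
    (σ ^ (finRotate _ m : ℕ)) r = σ ((σ ^ (m : ℕ)) r) := by
  have hlt := m.isLt
  have hmod : ((finRotate _ m : Fin _) : ℕ) = (m + 1) % Function.minimalPeriod σ r := by
    generalize Function.minimalPeriod σ r = n at m hlt
    cases n with
    | zero => exact m.elim0
    | succ n => simp [Fin.val_add]
  rw [hmod, ← mul_apply, ← pow_succ', ← iterate_eq_pow, ← iterate_eq_pow,
    Function.iterate_mod_minimalPeriod_eq]

/-- A system `R` of representatives of the orbits of `σ` identifies the underlying set with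
the disjoint union of the cycles through the elements of `R`. -/
theorem bijective_sigma_pow [Finite α] {σ : Perm α} {R : Finset α}
    (hR : ∀ x, ∃! r, r ∈ R ∧ σ.SameCycle r x) :
    Function.Bijective fun p : Σ r : R, Fin (Function.minimalPeriod σ (r : α)) =>
      (σ ^ (p.2 : ℕ)) (p.1 : α) := by
  constructor
  · rintro ⟨⟨r, hr⟩, m⟩ ⟨⟨s, hs⟩, l⟩ h
    have hrs : r = s :=
      (hR ((σ ^ (m : ℕ)) r)).unique ⟨hr, m, by simp⟩ ⟨hs, l, by simpa using h.symm⟩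
    subst hrs
    have hml : (m : ℕ) = l := Function.iterate_injOn_Iio_minimalPeriod (f := σ) (x := r)
      m.isLt l.isLt (by simpa only [iterate_eq_pow] using h)
    rw [Fin.ext hml]
  · intro x
    obtain ⟨r, ⟨hr, hx⟩, -⟩ := hR x
    obtain ⟨m, hm, rfl⟩ := hx.exists_pow_lt_minimalPeriod
    exact ⟨⟨⟨r, hr⟩, ⟨m, hm⟩⟩, rfl⟩

end Equiv.Perm

/-- Summing products of entries along a permutation gives a product of traces over its orbits. -/
theorem Equiv.Perm.sum_prod_apply_eq_prod_trace {α ι K : Type*} [Fintype α] [DecidableEq α]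
    [Fintype ι] [DecidableEq ι] [CommSemiring K] (σ : Equiv.Perm α) (B : α → Matrix ι ι K)
    {R : Finset α} (hR : ∀ x, ∃! r, r ∈ R ∧ σ.SameCycle r x) :
    ∑ h : α → ι, ∏ x, B x (h x) (h (σ x)) =
      ∏ r ∈ R, (((List.range (Set.ncard {x | σ.SameCycle r x})).map
        (fun m => B ((σ ^ m) r))).prod).trace := by
  let e := Equiv.ofBijective _ (bijective_sigma_pow hR)
  have he (r : R) (m : Fin (Function.minimalPeriod σ (r : α))) :
      σ (e ⟨r, m⟩) = e ⟨r, finRotate _ m⟩ := (σ.pow_finRotate_minimalPeriod r m).symm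
  rw [← Finset.prod_coe_sort R]
  simp_rw [ncard_sameCycle_s4, Matrix.trace_list_prod_range (σ.minimalPeriod_pos _).ne']
  rw [Finset.prod_univ_sum, Fintype.piFinset_univ,
    ← ((e.arrowCongr (Equiv.refl ι)).symm.trans (Equiv.piCurry fun _ _ => ι)).symm.sum_comp]
  refine Finset.sum_congr rfl fun h _ => ?_
  rw [← e.prod_comp, Fintype.prod_sigma]
  refine Finset.prod_congr rfl fun r _ => Finset.prod_congr rfl fun m _ => ?_
  have hsymm (p) : Sigma.uncurry h (e.symm (e p)) = h p.1 p.2 := by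
    rw [e.symm_apply_apply]
    rfl
  rw [he]
  exact congrArg₂ (B (e ⟨r, m⟩)) (hsymm _) (hsymm _)

/-- Trace formula for twisted permutation (Brauer) diagrams: the diagram
`b_{σ,S}` pairs `(l, [l ∈ S])` with `(σ l, ¬[σ l ∈ S])`; summing the entry
products over all functions `g : Fin k × Bool → Fin N` constant on each pair of
`b_{σ,S}` yields the product over the orbits of `σ` of the traces of the
products of the `B_l = A_l` or `A_lᵀ` (according to `l ∈ S`). -/
theorem stmt4 (N k : ℕ) (hN : 1 ≤ N) (hk : 1 ≤ k)
    (σ : Equiv.Perm (Fin k)) (S : Finset (Fin k))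
    (A B : Fin k → Matrix (Fin N) (Fin N) ℝ)
    (hB : ∀ l, B l = if l ∈ S then (A l)ᵀ else A l)
    (R : Finset (Fin k))
    (hR : ∀ x : Fin k, ∃! r, r ∈ R ∧ σ.SameCycle r x) :
    (∑ g ∈ Finset.univ.filter
        (fun g : Fin k × Bool → Fin N =>
          ∀ l : Fin k, g (l, decide (l ∈ S)) = g (σ l, !(decide (σ l ∈ S)))),
      ∏ l : Fin k, A l (g (l, true)) (g (l, false)))
      = ∏ r ∈ R,
          (((List.range (Set.ncard {x | σ.SameCycle r x})).map
              (fun m => B ((σ ^ m) r))).prod).trace := by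
  rw [← σ.sum_prod_apply_eq_prod_trace B hR]
  refine Finset.sum_bij' (fun g _ l => g (l, !(decide (l ∈ S))))
    (fun h _ p => if p.2 = decide (p.1 ∈ S) then h (σ p.1) else h p.1) ?_ ?_ ?_ ?_ ?_
  · simp
  · intro h _
    simp
  · intro g hg
    simp only [Finset.mem_filter, Finset.mem_univ, true_and] at hg
    ext1 ⟨l, b⟩
    by_cases hb : b = decide (l ∈ S)
    · simp [hb, hg]
    · have hb' : b = !decide (l ∈ S) := Bool.eq_not.mpr hb
      simp [hb']
  · intro h _
    simp
  · intro g hg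
    simp only [Finset.mem_filter, Finset.mem_univ, true_and] at hg
    refine Finset.prod_congr rfl fun l _ => ?_
    beta_reduce
    rw [← hg l, hB l]
    by_cases hl : l ∈ S <;> simp [hl]
end

section
/- Let b be an irreducible Brauer diagram of size k. Then the permutation b ∘ θ of V has exactly two orbits, each of cardinality k, and θ maps each of these two orbits onto the other. -/
namespace Equiv.Perm

variable {α : Type*} {σ τ : Perm α}

theorem conj_mul_of_involutive (hσ : ∀ x, σ (σ x) = x) (hτ : ∀ x, τ (τ x) = x) :
    τ * (σ * τ) * τ⁻¹ = (σ * τ)⁻¹ := by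
  have hσ' : σ⁻¹ = σ := by ext x; rw [inv_eq_iff_eq, hσ]
  have hτ' : τ⁻¹ = τ := by ext x; rw [inv_eq_iff_eq, hτ]
  rw [mul_inv_rev, hσ', mul_assoc, mul_inv_cancel_right, hτ']

theorem zpow_mul_apply_of_involutive (hσ : ∀ x, σ (σ x) = x) (hτ : ∀ x, τ (τ x) = x)
    (n : ℤ) (x : α) : τ (((σ * τ) ^ n) x) = ((σ * τ) ^ (-n)) (τ x) := by
  have h : τ * (σ * τ) ^ n * τ⁻¹ = (σ * τ) ^ (-n) := by
    rw [← conj_zpow, conj_mul_of_involutive hσ hτ, inv_zpow']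
  rw [← h]
  simp

theorem sameCycle_mul_apply_apply_of_involutive (hσ : ∀ x, σ (σ x) = x)
    (hτ : ∀ x, τ (τ x) = x) {x y : α} :
    (σ * τ).SameCycle (τ x) (τ y) ↔ (σ * τ).SameCycle x y := by
  rw [← sameCycle_inv, ← conj_mul_of_involutive hσ hτ, sameCycle_conj]
  simp

theorem not_sameCycle_mul_apply_of_involutive (hσ : ∀ x, σ (σ x) = x)
    (hτ : ∀ x, τ (τ x) = x) (hσ' : ∀ x, σ x ≠ x) (hτ' : ∀ x, τ x ≠ x) (x : α) :
    ¬ (σ * τ).SameCycle x (τ x) := by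
  rintro ⟨n, hn⟩
  obtain ⟨m, rfl | rfl⟩ := n.even_or_odd'
  · apply hτ' (((σ * τ) ^ m) x)
    rw [zpow_mul_apply_of_involutive hσ hτ, ← hn, ← mul_apply, ← zpow_add]
    congr 2
    ring
  · apply hσ' (τ (((σ * τ) ^ m) x))
    rw [← mul_apply, ← mul_apply, ← zpow_one_add,
      zpow_mul_apply_of_involutive hσ hτ, ← hn, ← mul_apply, ← zpow_add]
    congr 2
    ring

theorem sameCycle_mul_or_of_mem_closure (hσ : ∀ x, σ (σ x) = x) (hτ : ∀ x, τ (τ x) = x)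
    {g : Perm α} (hg : g ∈ Subgroup.closure ({σ, τ} : Set (Perm α))) (x : α) :
    (σ * τ).SameCycle x (g x) ∨ (σ * τ).SameCycle (τ x) (g x) := by
  have hmap {x y : α} : (σ * τ).SameCycle x y → (σ * τ).SameCycle (τ x) (τ y) :=
    (sameCycle_mul_apply_apply_of_involutive hσ hτ).2
  induction hg using Subgroup.closure_induction generalizing x with
  | mem g hg =>
    rcases hg with rfl | rfl
    · exact Or.inr ⟨1, by simp [hτ]⟩
    · exact Or.inr (SameCycle.refl _ _)
  | one => exact Or.inl (SameCycle.refl _ _)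
  | mul g h _ _ ihg ihh =>
    rw [mul_apply]
    rcases ihh x with h₁ | h₁ <;> rcases ihg (h x) with h₂ | h₂
    · exact Or.inl (h₁.trans h₂)
    · exact Or.inr ((hmap h₁).trans h₂)
    · exact Or.inr (h₁.trans h₂)
    · have h₃ := (hmap h₁).trans h₂
      rw [hτ] at h₃
      exact Or.inl h₃
  | inv g _ ih =>
    rcases ih (g⁻¹ x) with h | h <;> rw [← mul_apply g, mul_inv_cancel, one_apply] at h
    · exact Or.inl h.symm
    · have h' := hmap h
      rw [hτ] at h'
      exact Or.inr h'.symm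

theorem image_sameCycle_mul_of_involutive (hσ : ∀ x, σ (σ x) = x) (hτ : ∀ x, τ (τ x) = x)
    (x : α) : τ '' {y | (σ * τ).SameCycle x y} = {y | (σ * τ).SameCycle (τ x) y} := by
  ext y
  constructor
  · rintro ⟨z, hz, rfl⟩
    exact (sameCycle_mul_apply_apply_of_involutive hσ hτ).2 hz
  · intro hy
    refine ⟨τ y, ?_, hτ y⟩
    have h := (sameCycle_mul_apply_apply_of_involutive hσ hτ).2 hy
    rwa [hτ] at h

end Equiv.Perm

/-- An irreducible Brauer diagram `b` of size `k` (a fixed-point-free involution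
of `V = Fin k × Bool` such that the subgroup generated by `b` and the vertical
diagram `θ` acts transitively on `V`) is such that the permutation `b ∘ θ` has
exactly two orbits, each of cardinality `k`, and `θ` exchanges these two
orbits. -/
theorem stmt6 (k : ℕ) (hk : 1 ≤ k)
    (θ b : Equiv.Perm (Fin k × Bool))
    (hθ : ∀ v, θ v = (v.1, !v.2))
    (hbinv : ∀ v, b (b v) = v) (hbfree : ∀ v, b v ≠ v)
    (hirr : ∀ u v : Fin k × Bool,
      ∃ g ∈ Subgroup.closure ({b, θ} : Set (Equiv.Perm (Fin k × Bool))), g u = v) :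
    ∃ u v : Fin k × Bool,
      ¬ (b * θ).SameCycle u v ∧
      (∀ w, (b * θ).SameCycle u w ∨ (b * θ).SameCycle v w) ∧
      Set.ncard {w | (b * θ).SameCycle u w} = k ∧
      Set.ncard {w | (b * θ).SameCycle v w} = k ∧
      ⇑θ '' {w | (b * θ).SameCycle u w} = {w | (b * θ).SameCycle v w} ∧
      ⇑θ '' {w | (b * θ).SameCycle v w} = {w | (b * θ).SameCycle u w} := by
  have hθinv : ∀ v, θ (θ v) = v := fun v => by simp [hθ]
  have hθfree : ∀ v, θ v ≠ v := fun v h => by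
    simpa [hθ] using congrArg Prod.snd h
  let u : Fin k × Bool := (⟨0, hk⟩, false)
  have hnot := Equiv.Perm.not_sameCycle_mul_apply_of_involutive hbinv hθinv hbfree hθfree u
  have hcover : ∀ w, (b * θ).SameCycle u w ∨ (b * θ).SameCycle (θ u) w := fun w => by
    obtain ⟨g, hg, rfl⟩ := hirr u w
    exact Equiv.Perm.sameCycle_mul_or_of_mem_closure hbinv hθinv hg u
  have himage := Equiv.Perm.image_sameCycle_mul_of_involutive hbinv hθinv u
  have himage' := Equiv.Perm.image_sameCycle_mul_of_involutive hbinv hθinv (θ u)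
  rw [hθinv] at himage'
  have hcard : Set.ncard {w | (b * θ).SameCycle (θ u) w} =
      Set.ncard {w | (b * θ).SameCycle u w} := by
    rw [← himage, Set.ncard_image_of_injective _ θ.injective]
  have hunion : {w | (b * θ).SameCycle u w} ∪ {w | (b * θ).SameCycle (θ u) w} = Set.univ :=
    Set.eq_univ_of_forall hcover
  have hdisj : Disjoint {w | (b * θ).SameCycle u w} {w | (b * θ).SameCycle (θ u) w} :=
    Set.disjoint_left.2 fun _ h h' => hnot (h.trans h'.symm)
  have hsum := Set.ncard_union_eq hdisj
  rw [hunion, Set.ncard_univ, Nat.card_eq_fintype_card, Fintype.card_prod, Fintype.card_fin,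
    Fintype.card_bool] at hsum
  exact ⟨u, θ u, hnot, hcover, by lia, by lia, himage, himage'⟩
end

section
/- Let b be an irreducible Brauer diagram of size k. Call a Brauer diagram P a permutation diagram if P maps every bottom vertex to a top vertex. Then the twist orbit {g_S ∘ b ∘ g_S : S ⊆ Fin k} of b contains a permutation diagram P, every permutation diagram in this twist orbit equals P or θ ∘ P ∘ θ, and both P and θ ∘ P ∘ θ belong to the twist orbit. (θ ∘ P ∘ θ is the transpose of the diagram P; for k ≥ 3 these are two distinct permutation diagrams.) -/
/-- The twist `g_S` of `Fin k × Bool` by a set `S ⊆ Fin k`: it flips the `Bool`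
component over the sites in `S`. -/
def gS {k : ℕ} (S : Finset (Fin k)) : Equiv.Perm (Fin k × Bool) :=
  Function.Involutive.toPerm (fun v => (v.1, if v.1 ∈ S then !v.2 else v.2))
    (by intro v; by_cases h : v.1 ∈ S <;> simp [h])

section TwoColoring

variable {α : Type*} {b θ : Equiv.Perm α}

/-- A predicate preserved by `b` and `θ` holds everywhere as soon as it holds at one point,
if `b` and `θ` generate a transitive group. -/
theorem forall_of_transitive_closure
    (hirr : ∀ u v : α, ∃ g ∈ Subgroup.closure ({b, θ} : Set (Equiv.Perm α)), g u = v)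
    (hb : ∀ v, b (b v) = v) (hθ : ∀ v, θ (θ v) = v)
    (p : α → Prop) (hpb : ∀ v, p v → p (b v)) (hpθ : ∀ v, p v → p (θ v))
    {u : α} (hu : p u) (v : α) : p v := by
  obtain ⟨g, hg, rfl⟩ := hirr u v
  suffices ∀ w, p (g w) ↔ p w from (this u).2 hu
  induction hg using Subgroup.closure_induction with
  | mem x hx =>
    intro w
    rcases hx with rfl | rfl
    · exact ⟨fun h => by simpa [hb] using hpb _ h, hpb w⟩
    · exact ⟨fun h => by simpa [hθ] using hpθ _ h, hpθ w⟩
  | one => simp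
  | mul x y _ _ hx hy => intro w; rw [Equiv.Perm.mul_apply, hx, hy]
  | inv x _ hx => intro w; rw [← hx, ← Equiv.Perm.mul_apply, mul_inv_cancel,
      Equiv.Perm.one_apply]

/-- In the dihedral group generated by two fixed-point-free involutions, `θ v` is never
reached from `v` by a rotation. -/
theorem zpow_mul_apply_ne (hb : ∀ v, b (b v) = v) (hθ : ∀ v, θ (θ v) = v)
    (hb' : ∀ v, b v ≠ v) (hθ' : ∀ v, θ v ≠ v) (n : ℤ) (v : α) :
    ((θ * b) ^ n) v ≠ θ v := by
  intro h
  have hbb : b * b = 1 := Equiv.ext hb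
  have hθθ : θ * θ = 1 := Equiv.ext hθ
  have hbi : b⁻¹ = b := inv_eq_of_mul_eq_one_left hbb
  have hθi : θ⁻¹ = θ := inv_eq_of_mul_eq_one_left hθθ
  have hconj : SemiconjBy θ (θ * b) (θ * b)⁻¹ := by
    simp [SemiconjBy, mul_inv_rev, hbi, hθi, mul_assoc, hθθ, ← mul_assoc θ θ]
  have key (m : ℤ) : ((θ * b) ^ (n - m)) v = θ (((θ * b) ^ m) v) := by
    have h1 := DFunLike.congr_fun (hconj.zpow_right m) v
    simp only [Equiv.Perm.mul_apply θ, Equiv.Perm.mul_apply ((θ * b)⁻¹ ^ m)] at h1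
    rw [h1, ← h, ← Equiv.Perm.mul_apply, inv_zpow', ← zpow_add, neg_add_eq_sub]
  rcases Int.even_or_odd' n with ⟨m, rfl | rfl⟩
  · apply hθ' (((θ * b) ^ m) v)
    rw [← key m, two_mul, add_sub_cancel_right]
  · apply hb' (((θ * b) ^ m) v)
    apply θ.injective
    rw [← key m, show 2 * m + 1 - m = 1 + m by ring, zpow_add, zpow_one]
    rfl

/-- Two fixed-point-free involutions generating a transitive group admit a common
alternating 2-colouring. -/
theorem exists_alternating_coloring [Nonempty α]
    (hirr : ∀ u v : α, ∃ g ∈ Subgroup.closure ({b, θ} : Set (Equiv.Perm α)), g u = v)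
    (hb : ∀ v, b (b v) = v) (hθ : ∀ v, θ (θ v) = v)
    (hb' : ∀ v, b v ≠ v) (hθ' : ∀ v, θ v ≠ v) :
    ∃ c : α → Bool, (∀ v, c (θ v) = !c v) ∧ ∀ v, c (b v) = !c v := by
  classical
  obtain ⟨u⟩ := ‹Nonempty α›
  have hO : ∀ v, (θ * b).SameCycle u v ∨ (θ * b).SameCycle u (θ v) := by
    refine forall_of_transitive_closure hirr hb hθ _ ?_ ?_ (Or.inl (.refl _ u))
    · rintro v (h | h)
      · exact Or.inr (Equiv.Perm.sameCycle_apply_right.2 h)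
      · refine Or.inl (Equiv.Perm.sameCycle_apply_right.1 ?_)
        simpa [hb] using h
    · rintro v (h | h)
      · exact Or.inr (by rwa [hθ])
      · exact Or.inl h
  have hc : ∀ v, (θ * b).SameCycle u (θ v) ↔ ¬ (θ * b).SameCycle u v := by
    intro v
    refine ⟨fun h h' => ?_, fun h => (hO v).resolve_left h⟩
    obtain ⟨n, hn⟩ := h'.symm.trans h
    exact zpow_mul_apply_ne hb hθ hb' hθ' n v hn
  refine ⟨fun v => decide ((θ * b).SameCycle u v), fun v => by simp [hc], fun v => ?_⟩
  have h := hc (b v)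
  have h2 : (θ * b).SameCycle u (θ (b v)) ↔ _ :=
    Equiv.Perm.sameCycle_apply_right (f := θ * b) (x := u) (y := v)
  rw [h2] at h
  simp [h]

end TwoColoring

section Twist

variable {k : ℕ}

@[simp]
theorem gS_fst (S : Finset (Fin k)) (v : Fin k × Bool) : (gS S v).1 = v.1 := rfl

theorem gS_snd (S : Finset (Fin k)) (v : Fin k × Bool) :
    (gS S v).2 = if v.1 ∈ S then !v.2 else v.2 := rfl

@[simp]
theorem gS_gS (S : Finset (Fin k)) (v : Fin k × Bool) : gS S (gS S v) = v := by
  ext <;> by_cases h : v.1 ∈ S <;> simp [gS_snd, h]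

/-- An involutive diagram mapping every bottom vertex to a top vertex also maps every top
vertex to a bottom vertex. -/
theorem snd_apply_eq_not {Q : Equiv.Perm (Fin k × Bool)} (hQ : ∀ v, Q (Q v) = v)
    (h : ∀ x, (Q (x, false)).2 = true) (v : Fin k × Bool) : (Q v).2 = !v.2 := by
  obtain ⟨x, _ | _⟩ := v
  · exact h x
  · have hinj : Function.Injective fun y => (Q (y, false)).1 := by
      intro y z hyz
      have : Q (y, false) = Q (z, false) := Prod.ext hyz ((h y).trans (h z).symm)
      simpa using Q.injective this
    obtain ⟨y, hy⟩ := Finite.surjective_of_injective hinj x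
    have : Q (y, false) = (x, true) := Prod.ext hy (h y)
    simp [← this, hQ]

end Twist

/-- The twist orbit of an irreducible Brauer diagram `b` contains exactly two
permutation diagrams (diagrams mapping every bottom vertex to a top vertex),
and they are transposes of one another: `P` and `θ ∘ P ∘ θ`. -/
theorem stmt7 (k : ℕ) (hk : 1 ≤ k)
    (θ b : Equiv.Perm (Fin k × Bool))
    (hθ : ∀ v, θ v = (v.1, !v.2))
    (hbinv : ∀ v, b (b v) = v) (hbfree : ∀ v, b v ≠ v)
    (hirr : ∀ u v : Fin k × Bool,
      ∃ g ∈ Subgroup.closure ({b, θ} : Set (Equiv.Perm (Fin k × Bool))), g u = v) :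
    ∃ P : Equiv.Perm (Fin k × Bool),
      (∃ S : Finset (Fin k), P = gS S * b * gS S) ∧
      (∀ x : Fin k, (P (x, false)).2 = true) ∧
      (∀ Q : Equiv.Perm (Fin k × Bool),
        (∃ S : Finset (Fin k), Q = gS S * b * gS S) →
        (∀ x : Fin k, (Q (x, false)).2 = true) →
        Q = P ∨ Q = θ * P * θ) ∧
      (∃ S : Finset (Fin k), θ * P * θ = gS S * b * gS S) := by
  have hθθ : ∀ v, θ (θ v) = v := fun v => by simp [hθ]
  have : Nonempty (Fin k × Bool) := ⟨(⟨0, hk⟩, false)⟩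
  obtain ⟨c, hcθ, hcb⟩ := exists_alternating_coloring hirr hbinv hθθ hbfree
    fun v h => Bool.not_ne_self v.2 (by rw [hθ] at h; exact congrArg Prod.snd h)
  obtain ⟨S, hS⟩ : ∃ S : Finset (Fin k), ∀ v, (gS S v).2 = c v := by
    refine ⟨Finset.univ.filter fun x => c (x, false) = true, ?_⟩
    rintro ⟨x, _ | _⟩
    · by_cases h : c (x, false) = true <;> simp [gS_snd, h]
    · have hx : c (x, true) = !c (x, false) := by rw [← hcθ, hθ]; rfl
      by_cases h : c (x, false) = true <;> simp [gS_snd, hx, h]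
  have hcompl : θ * gS S = gS Sᶜ := by
    ext v <;> by_cases h : v.1 ∈ S <;> simp [hθ, gS_snd, h]
  have hcompl' : gS S * θ = gS Sᶜ := by
    ext v <;> by_cases h : v.1 ∈ S <;> simp [hθ, gS_snd, h]
  have hconj : θ * (gS S * b * gS S) * θ = gS Sᶜ * b * gS Sᶜ := by
    rw [← mul_assoc, ← mul_assoc, hcompl, mul_assoc _ (gS S), hcompl']
  refine ⟨gS S * b * gS S, ⟨S, rfl⟩, fun x => ?_, ?_, ⟨Sᶜ, hconj⟩⟩
  · rw [Equiv.Perm.mul_apply, Equiv.Perm.mul_apply, hS, hcb, ← hS, gS_gS]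
    rfl
  · rintro Q ⟨T, rfl⟩ hQ
    have hQ' := snd_apply_eq_not (fun v => by simp [hbinv]) hQ
    have hTb : ∀ v, (gS T (b v)).2 = !(gS T v).2 := fun v => by
      simpa using hQ' (gS T v)
    have hTθ : ∀ v, (gS T (θ v)).2 = !(gS T v).2 := fun v => by
      by_cases h : v.1 ∈ T <;> simp [hθ, gS_snd, h]
    have hconst (d : Bool) (u) (hu : ((gS T u).2 ^^ c u) = d) (v) : ((gS T v).2 ^^ c v) = d :=
      forall_of_transitive_closure hirr hbinv hθθ (fun v => ((gS T v).2 ^^ c v) = d)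
        (fun v h => by simpa [hTb, hcb] using h) (fun v h => by simpa [hTθ, hcθ] using h) hu v
    obtain ⟨u⟩ := this
    have hT := hconst _ u rfl
    generalize ((gS T u).2 ^^ c u) = d at hT
    rcases d with _ | _
    · left
      have : gS T = gS S := by
        ext v
        · rfl
        · have := hT v
          rw [hS]
          simpa using this
      rw [this]
    · right
      have : gS T = θ * gS S := by
        ext v
        · simp [hθ]
        · have := hT v
          rw [Equiv.Perm.mul_apply, hθ, hS]
          revert this
          cases (gS T v).2 <;> cases c v <;> simp
      rw [this, hcompl, hconj]
end

section
/- Let b be an irreducible Brauer diagram of size k and let i ≠ j in Fin k. Then the number of orbits on V of the subgroup generated by b and the projector diagram e_{ij} is 1 or 2, and it equals 2 if and only if (i, false) and (j, false) lie in different orbits of the permutation b ∘ θ. Likewise, the number of orbits on V of the subgroup generated by b and the transposition diagram τ_{ij} is 1 or 2, and it equals 2 if and only if (i, false) and (j, false) lie in the same orbit of b ∘ θ. -/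
/-- The number of cycles of the join of the pair partitions of a family `s` of
involutions of `V`: the number of orbits of the subgroup they generate. -/
noncomputable def ncSet {V : Type*} (s : Set (Equiv.Perm V)) : ℕ :=
  Nat.card (MulAction.orbitRel.Quotient (Subgroup.closure s) V)

section OrbitCounting

variable {V : Type*}

theorem mem_iff_of_mem_closure {s : Set (Equiv.Perm V)} {T : Set V}
    (hT : ∀ g ∈ s, ∀ x, g x ∈ T ↔ x ∈ T) {g : Equiv.Perm V}
    (hg : g ∈ Subgroup.closure s) (x : V) : g x ∈ T ↔ x ∈ T := by
  induction hg using Subgroup.closure_induction generalizing x with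
  | mem g hg => exact hT g hg x
  | one => rfl
  | mul g h _ _ ihg ihh => rw [Equiv.Perm.mul_apply, ihg, ihh]
  | inv g _ ih => rw [← ih, ← Equiv.Perm.mul_apply, mul_inv_cancel, Equiv.Perm.one_apply]

theorem orbit_closure_subset {s : Set (Equiv.Perm V)} {T : Set V}
    (hT : ∀ g ∈ s, ∀ x, g x ∈ T ↔ x ∈ T) {a : V} (ha : a ∈ T) :
    MulAction.orbit (Subgroup.closure s) a ⊆ T := by
  rintro _ ⟨⟨g, hg⟩, rfl⟩
  exact (mem_iff_of_mem_closure hT hg a).2 ha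

theorem apply_mem_orbit_closure_iff {s : Set (Equiv.Perm V)} {g : Equiv.Perm V} (hg : g ∈ s)
    (a x : V) : g x ∈ MulAction.orbit (Subgroup.closure s) a ↔
      x ∈ MulAction.orbit (Subgroup.closure s) a := by
  have h : g x = (⟨g, Subgroup.subset_closure hg⟩ : Subgroup.closure s) • x := rfl
  rw [h, ← MulAction.orbit_eq_iff, ← MulAction.orbit_eq_iff, MulAction.orbit_smul]

theorem ncSet_eq_one {s : Set (Equiv.Perm V)} {a : V}
    (h : ∀ x, x ∈ MulAction.orbit (Subgroup.closure s) a) : ncSet s = 1 := by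
  refine Nat.card_eq_one_iff_exists.2 ⟨Quotient.mk'' a, fun q => ?_⟩
  induction q using Quotient.inductionOn'
  exact Quotient.sound' (h _)

theorem ncSet_eq_two {s : Set (Equiv.Perm V)} {a a' : V}
    (h : ∀ x, x ∈ MulAction.orbit (Subgroup.closure s) a ∨
      x ∈ MulAction.orbit (Subgroup.closure s) a')
    (h' : a' ∉ MulAction.orbit (Subgroup.closure s) a) : ncSet s = 2 := by
  refine Nat.card_eq_two_iff.2 ⟨Quotient.mk'' a', Quotient.mk'' a, fun hq => h' ?_, ?_⟩
  · exact Quotient.exact' hq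
  · refine Set.eq_univ_of_forall fun q => ?_
    induction q using Quotient.inductionOn' with
    | h x =>
      rcases h x with hx | hx
      · exact Or.inr (Quotient.sound' hx)
      · exact Or.inl (Quotient.sound' hx)

end OrbitCounting

section TwoInvolutions

variable {V : Type*} {b θ : Equiv.Perm V}

/-- If `b` and `θ` are fixed-point-free involutions, `θ` moves every point to another orbit
of `b * θ`. -/
theorem not_sameCycle_apply (hb : ∀ v, b (b v) = v) (hb' : ∀ v, b v ≠ v)
    (hθ : ∀ v, θ (θ v) = v) (hθ' : ∀ v, θ v ≠ v) (x : V) : ¬ (b * θ).SameCycle x (θ x) := by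
  rintro ⟨n, hn⟩
  have hbb : b⁻¹ = b := by ext v; rw [Equiv.Perm.inv_eq_iff_eq, hb]
  have hθθ : θ⁻¹ = θ := by ext v; rw [Equiv.Perm.inv_eq_iff_eq, hθ]
  have hconj (m : ℤ) (v : V) : θ (((b * θ) ^ m) v) = ((b * θ) ^ (-m)) (θ v) := by
    have h1 : θ * (b * θ) ^ m * θ⁻¹ = (b * θ) ^ (-m) := by
      rw [← conj_zpow, zpow_neg, ← inv_zpow, mul_inv_rev, hbb, hθθ]
      congr 1
      ext v
      simp [hθ]
    rw [← h1]
    simp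
  obtain ⟨m, rfl | rfl⟩ := Int.even_or_odd' n
  · apply hθ' (((b * θ) ^ m) x)
    rw [hconj, ← hn, ← Equiv.Perm.mul_apply, ← zpow_add]
    congr 2; ring
  · apply hb' (θ (((b * θ) ^ m) x))
    have h1 : ((b * θ) ^ (m + 1)) x = b (θ (((b * θ) ^ m) x)) := by
      rw [add_comm, zpow_add]; simp
    rw [← h1, ← hθ (((b * θ) ^ (m + 1)) x), hconj (m + 1), ← hn]
    refine congrArg θ ?_
    rw [← Equiv.Perm.mul_apply, ← zpow_add]
    congr 2; ring

/-- If `b` and `θ` are involutions generating a transitive group, every point or its `θ`-partner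
lies in a given orbit of `b * θ`. -/
theorem sameCycle_or_sameCycle_apply (hb : ∀ v, b (b v) = v) (hθ : ∀ v, θ (θ v) = v)
    (hirr : ∀ u v : V, ∃ g ∈ Subgroup.closure ({b, θ} : Set (Equiv.Perm V)), g u = v) (a x : V) :
    (b * θ).SameCycle a x ∨ (b * θ).SameCycle a (θ x) := by
  set T : Set V := {x | (b * θ).SameCycle a x ∨ (b * θ).SameCycle a (θ x)}
  have hbT (x : V) (hx : x ∈ T) : b x ∈ T := by
    rcases hx with h | h
    · refine Or.inr (Equiv.Perm.sameCycle_apply_right.1 ?_)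
      simpa [hb, hθ] using h
    · refine Or.inl ?_
      simpa [hθ] using Equiv.Perm.sameCycle_apply_right.2 h
  have hθT (x : V) (hx : x ∈ T) : θ x ∈ T := by
    rcases hx with h | h
    · exact Or.inr (by rwa [hθ])
    · exact Or.inl h
  obtain ⟨g, hg, rfl⟩ := hirr a x
  refine (mem_iff_of_mem_closure (T := T) ?_ hg a).2 (Or.inl (Equiv.Perm.SameCycle.refl _ _))
  rintro g (rfl | rfl) x
  · exact ⟨fun h => by simpa [hb] using hbT _ h, hbT x⟩
  · exact ⟨fun h => by simpa [hθ] using hθT _ h, hθT x⟩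

variable {e : Equiv.Perm V} {a c : V}

/-- `e` is the involution obtained from `θ` by replacing the pairs `{a, θ a}` and `{c, θ c}`
by `{a, c}` and `{θ a, θ c}`. -/
structure IsReconnection (θ e : Equiv.Perm V) (a c : V) : Prop where
  left : e a = c
  right : e c = a
  left' : e (θ a) = θ c
  right' : e (θ c) = θ a
  other : ∀ x, x ≠ a → x ≠ c → x ≠ θ a → x ≠ θ c → e x = θ x

theorem IsReconnection.apply_apply (h : IsReconnection θ e a c) (hθ : ∀ v, θ (θ v) = v) (x : V) :
    e (e x) = x := by
  by_cases h1 : x = a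
  · rw [h1, h.left, h.right]
  by_cases h2 : x = c
  · rw [h2, h.right, h.left]
  by_cases h3 : x = θ a
  · rw [h3, h.left', h.right']
  by_cases h4 : x = θ c
  · rw [h4, h.right', h.left']
  rw [h.other x h1 h2 h3 h4, h.other, hθ]
  · rintro rfl; exact h3 (hθ x).symm
  · rintro rfl; exact h4 (hθ x).symm
  · exact fun h' => h1 (θ.injective h')
  · exact fun h' => h2 (θ.injective h')

theorem IsReconnection.mem_orbit_or (h : IsReconnection θ e a c) (hθ : ∀ v, θ (θ v) = v)
    (hirr : ∀ u v : V, ∃ g ∈ Subgroup.closure ({b, θ} : Set (Equiv.Perm V)), g u = v) (x : V) :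
    x ∈ MulAction.orbit (Subgroup.closure {b, e}) a ∨
      x ∈ MulAction.orbit (Subgroup.closure {b, e}) (θ a) := by
  set A := MulAction.orbit (Subgroup.closure {b, e}) a
  set A' := MulAction.orbit (Subgroup.closure {b, e}) (θ a)
  have hbA (x : V) : b x ∈ A ↔ x ∈ A := apply_mem_orbit_closure_iff (by simp) a x
  have hbA' (x : V) : b x ∈ A' ↔ x ∈ A' := apply_mem_orbit_closure_iff (by simp) (θ a) x
  have heA (x : V) : e x ∈ A ↔ x ∈ A := apply_mem_orbit_closure_iff (by simp) a x
  have heA' (x : V) : e x ∈ A' ↔ x ∈ A' := apply_mem_orbit_closure_iff (by simp) (θ a) x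
  have haA : a ∈ A := MulAction.mem_orbit_self a
  have haA' : θ a ∈ A' := MulAction.mem_orbit_self (θ a)
  have hcA : c ∈ A := by rw [← h.left, heA]; exact haA
  have hcA' : θ c ∈ A' := by rw [← h.left', heA']; exact haA'
  have hθT (x : V) (hx : x ∈ A ∪ A') : θ x ∈ A ∪ A' := by
    by_cases h1 : x = a
    · exact Or.inr (h1 ▸ haA')
    by_cases h2 : x = c
    · exact Or.inr (h2 ▸ hcA')
    by_cases h3 : x = θ a
    · rw [h3, hθ]; exact Or.inl haA
    by_cases h4 : x = θ c
    · rw [h4, hθ]; exact Or.inl hcA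
    rw [← h.other x h1 h2 h3 h4]
    simpa [heA, heA'] using hx
  obtain ⟨g, hg, rfl⟩ := hirr a x
  refine (mem_iff_of_mem_closure (T := A ∪ A') ?_ hg a).2 (Or.inl haA)
  rintro g (rfl | rfl) x
  · simp [hbA, hbA']
  · exact ⟨fun h => by simpa [hθ] using hθT _ h, hθT x⟩

theorem IsReconnection.mem_orbit_of_sameCycle [Finite V] (h : IsReconnection θ e a c)
    (hb : ∀ v, b (b v) = v) (hb' : ∀ v, b v ≠ v)
    (hθ : ∀ v, θ (θ v) = v) (hθ' : ∀ v, θ v ≠ v) (hac : (b * θ).SameCycle a c) :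
    θ a ∈ MulAction.orbit (Subgroup.closure {b, e}) a := by
  set A := MulAction.orbit (Subgroup.closure {b, e}) a
  have hbA (x : V) : b x ∈ A ↔ x ∈ A := apply_mem_orbit_closure_iff (by simp) a x
  have heA (x : V) : e x ∈ A ↔ x ∈ A := apply_mem_orbit_closure_iff (by simp) a x
  have haA : a ∈ A := MulAction.mem_orbit_self a
  by_contra haA'
  have hcA' : θ c ∉ A := by rwa [← h.left', heA]
  have hinv : (b * θ)⁻¹ = θ * b := by
    ext v; rw [Equiv.Perm.inv_eq_iff_eq]; simp [hb, hθ]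
  have hdisj (y : V) (hy : (b * θ).SameCycle a (θ y)) : ¬ (b * θ).SameCycle a y :=
    fun hy' => not_sameCycle_apply hb hb' hθ hθ' y (hy'.symm.trans hy)
  have key (m : ℕ) : ((b * θ)⁻¹ ^ m) a ∈ A := by
    induction m with
    | zero => exact haA
    | succ m ih =>
      set x := ((b * θ)⁻¹ ^ m) a with hx
      have hxs : ((b * θ)⁻¹ ^ (m + 1)) a = θ (b x) := by
        rw [pow_succ', Equiv.Perm.mul_apply, ← hx, hinv, Equiv.Perm.mul_apply]
      have hsame : (b * θ).SameCycle a (θ (b x)) := by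
        rw [← hxs, ← Equiv.Perm.sameCycle_inv]
        exact ⟨(m + 1 : ℕ), by rw [zpow_natCast]⟩
      have hbx : b x ∈ A := (hbA x).2 ih
      rw [hxs, ← h.other (b x), heA]
      · exact hbx
      · intro h'
        exact hdisj _ hsame (h' ▸ Equiv.Perm.SameCycle.refl _ _)
      · intro h'
        exact hdisj _ hsame (h' ▸ hac)
      · intro h'; exact haA' (h' ▸ hbx)
      · intro h'; exact hcA' (h' ▸ hbx)
  have hlast : (b * θ)⁻¹.SameCycle a (b (θ a)) := by
    rw [Equiv.Perm.sameCycle_inv]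
    exact ⟨1, by simp⟩
  obtain ⟨m, hm⟩ := hlast.exists_nat_pow_eq
  have := key m
  rw [hm, hbA] at this
  exact haA' this

theorem IsReconnection.notMem_orbit_of_sameCycle [Finite V] (h : IsReconnection θ e a c)
    (hne : a ≠ θ c) (hb : ∀ v, b (b v) = v) (hb' : ∀ v, b v ≠ v)
    (hθ : ∀ v, θ (θ v) = v) (hθ' : ∀ v, θ v ≠ v) (hac : (b * θ).SameCycle a (θ c)) :
    θ a ∉ MulAction.orbit (Subgroup.closure {b, e}) a := by
  have hinv : (b * θ)⁻¹ = θ * b := by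
    ext v; rw [Equiv.Perm.inv_eq_iff_eq]; simp [hb, hθ]
  have hdisj (y : V) (hy : (b * θ).SameCycle a (θ y)) : ¬ (b * θ).SameCycle a y :=
    fun hy' => not_sameCycle_apply hb hb' hθ hθ' y (hy'.symm.trans hy)
  -- `p l` walks backwards along the orbit of `a`; `n` is the first time it reaches `θ c`.
  set p : ℕ → V := fun l => ((b * θ)⁻¹ ^ l) a with hp
  have hp0 : p 0 = a := rfl
  have hps (l : ℕ) : p (l + 1) = θ (b (p l)) := by
    simp only [hp]
    rw [pow_succ', Equiv.Perm.mul_apply, hinv, Equiv.Perm.mul_apply]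
  have hpO (l : ℕ) : (b * θ).SameCycle a (p l) := by
    rw [← Equiv.Perm.sameCycle_inv]
    exact ⟨l, by rw [zpow_natCast]⟩
  have hex : ∃ n, p n = θ c := (Equiv.Perm.sameCycle_inv.2 hac).exists_nat_pow_eq
  classical
  obtain ⟨n, hn, hmin⟩ : ∃ n, p n = θ c ∧ ∀ m < n, p m ≠ θ c :=
    ⟨Nat.find hex, Nat.find_spec hex, fun m hm => Nat.find_min hex hm⟩
  have hn0 : 0 < n := Nat.pos_of_ne_zero fun h0 => hne (by rw [← hn, h0, hp0])
  have hper (l : ℕ) (hl0 : 0 < l) (hl : l ≤ n) : p l ≠ a := by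
    intro hla
    refine hmin (n - l) (by omega) ?_
    rw [← hn]
    simp only [hp] at hla ⊢
    conv_rhs => rw [← Nat.sub_add_cancel hl, pow_add, Equiv.Perm.mul_apply, hla]
  have hpa' (l : ℕ) : p l ≠ θ a := fun h' =>
    hdisj a (h' ▸ hpO l) (Equiv.Perm.SameCycle.refl _ _)
  have hpc (l : ℕ) : p l ≠ c := fun h' => hdisj c hac (h' ▸ hpO l)
  set T : Set V := {x | ∃ l < n, x = p l ∨ x = b (p l)}
  have hbT (x : V) (hx : x ∈ T) : b x ∈ T := by
    obtain ⟨l, hl, rfl | rfl⟩ := hx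
    · exact ⟨l, hl, Or.inr rfl⟩
    · exact ⟨l, hl, Or.inl (hb _)⟩
  have hbp (l : ℕ) : b (p l) = θ (p (l + 1)) := by rw [hps, hθ]
  have hep (l : ℕ) (hl0 : 0 < l) (hl : l < n) : e (p l) = θ (p l) :=
    h.other _ (hper l hl0 hl.le) (hpc l) (hpa' l) (hmin l hl)
  have heT (x : V) (hx : x ∈ T) : e x ∈ T := by
    obtain ⟨l, hl, rfl | rfl⟩ := hx
    · rcases l with - | l
      · refine ⟨n - 1, by omega, Or.inr ?_⟩
        rw [hbp, Nat.sub_add_cancel hn0, hn, hp0, h.left, hθ]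
      · exact ⟨l, by omega, Or.inr (by rw [hbp, hep _ (by omega) hl])⟩
    · rcases Nat.lt_or_eq_of_le (Nat.succ_le_of_lt hl) with hl' | hl'
      · refine ⟨l + 1, hl', Or.inl ?_⟩
        rw [hbp, ← hep _ (by omega) hl', h.apply_apply hθ]
      · refine ⟨0, hn0, Or.inl ?_⟩
        rw [hbp, show l + 1 = n from hl', hn, hθ, h.right, hp0]
  have haT : a ∈ T := ⟨0, hn0, Or.inl hp0.symm⟩
  intro hmem
  have hsub := orbit_closure_subset (s := {b, e}) (T := T) (by
    rintro g (rfl | rfl) x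
    · exact ⟨fun h' => by simpa [hb] using hbT _ h', hbT x⟩
    · exact ⟨fun h' => by simpa [h.apply_apply hθ] using heT _ h', heT x⟩) haT
  obtain ⟨l, hl, h' | h'⟩ := hsub hmem
  · exact hpa' l h'.symm
  · rw [hbp] at h'
    exact hper (l + 1) (by omega) hl (θ.injective h').symm

/-- Reconnecting the single cycle of `b ∨ θ` yields one cycle if `a` and `c` lie in the same orbit
of `b * θ`, and two cycles otherwise. -/
theorem IsReconnection.ncSet_eq [Finite V] (h : IsReconnection θ e a c)
    (hne : a ≠ θ c) (hb : ∀ v, b (b v) = v) (hb' : ∀ v, b v ≠ v)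
    (hθ : ∀ v, θ (θ v) = v) (hθ' : ∀ v, θ v ≠ v)
    (hirr : ∀ u v : V, ∃ g ∈ Subgroup.closure ({b, θ} : Set (Equiv.Perm V)), g u = v) :
    ((b * θ).SameCycle a c → ncSet {b, e} = 1) ∧
      ((b * θ).SameCycle a (θ c) → ncSet {b, e} = 2) := by
  have hor := h.mem_orbit_or hθ hirr
  refine ⟨fun hac => ?_, fun hac => ?_⟩
  · have hmem := h.mem_orbit_of_sameCycle hb hb' hθ hθ' hac
    refine ncSet_eq_one fun x => (hor x).elim id fun hx => ?_
    rwa [MulAction.orbit_eq_iff.2 hmem] at hx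
  · exact ncSet_eq_two hor (h.notMem_orbit_of_sameCycle hne hb hb' hθ hθ' hac)

end TwoInvolutions

/-- For an irreducible Brauer diagram `b` and `i ≠ j`, the number of orbits of
the group generated by `b` and the projector diagram `e_{ij}` is `1` or `2`,
and equals `2` iff `(i,false)` and `(j,false)` lie in different orbits of
`b ∘ θ`; dually for the transposition diagram `τ_{ij}`. -/
theorem stmt8 (k : ℕ) (hk : 1 ≤ k)
    (θ b e τ : Equiv.Perm (Fin k × Bool)) (i j : Fin k) (hij : i ≠ j)
    (hθ : ∀ v, θ v = (v.1, !v.2))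
    (hbinv : ∀ v, b (b v) = v) (hbfree : ∀ v, b v ≠ v)
    (hirr : ∀ u v : Fin k × Bool,
      ∃ g ∈ Subgroup.closure ({b, θ} : Set (Equiv.Perm (Fin k × Bool))), g u = v)
    (he : ∀ (x : Fin k) (ε : Bool),
      e (x, ε) = if x = i then (j, ε) else if x = j then (i, ε) else (x, !ε))
    (hτ : ∀ (x : Fin k) (ε : Bool),
      τ (x, ε) = if x = i then (j, !ε) else if x = j then (i, !ε) else (x, !ε)) :
    (ncSet ({b, e} : Set (Equiv.Perm (Fin k × Bool))) = 1 ∨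
      ncSet ({b, e} : Set (Equiv.Perm (Fin k × Bool))) = 2) ∧
    (ncSet ({b, e} : Set (Equiv.Perm (Fin k × Bool))) = 2 ↔
      ¬ (b * θ).SameCycle (i, false) (j, false)) ∧
    (ncSet ({b, τ} : Set (Equiv.Perm (Fin k × Bool))) = 1 ∨
      ncSet ({b, τ} : Set (Equiv.Perm (Fin k × Bool))) = 2) ∧
    (ncSet ({b, τ} : Set (Equiv.Perm (Fin k × Bool))) = 2 ↔
      (b * θ).SameCycle (i, false) (j, false)) := by
  have hθθ (v : Fin k × Bool) : θ (θ v) = v := by simp [hθ]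
  have hθfree (v : Fin k × Bool) : θ v ≠ v := by simp [hθ, Prod.ext_iff]
  have hji : j ≠ i := hij.symm
  have hrec_e : IsReconnection θ e (i, false) (j, false) := by
    refine ⟨by simp [he], by simp [he, hji], by simp [he, hθ], by simp [he, hθ, hji], ?_⟩
    rintro ⟨x, ε⟩ h1 h2 h3 h4
    cases ε <;> simp_all
  have hrec_τ : IsReconnection θ τ (i, false) (j, true) := by
    refine ⟨by simp [hτ], by simp [hτ, hji], by simp [hτ, hθ], by simp [hτ, hθ, hji], ?_⟩
    rintro ⟨x, ε⟩ h1 h2 h3 h4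
    cases ε <;> simp_all
  have hce : θ (j, false) = (j, true) := by simp [hθ]
  have hcτ : θ (j, true) = (j, false) := by simp [hθ]
  have h_e := hrec_e.ncSet_eq (by simp [hθ]) hbinv hbfree hθθ hθfree hirr
  have h_τ := hrec_τ.ncSet_eq (by simp [hθ, hij]) hbinv hbfree hθθ hθfree hirr
  have hor := sameCycle_or_sameCycle_apply hbinv hθθ hirr (i, false) (j, false)
  rw [hce] at h_e hor
  rw [hcτ] at h_τ
  by_cases hs : (b * θ).SameCycle (i, false) (j, false)
  · simp [h_e.1 hs, h_τ.2 hs, hs]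
  · have hs' := hor.resolve_left hs
    simp [h_e.2 hs', h_τ.1 hs', hs]
end

section
/- Let b be a Brauer diagram of size k and let i ≠ j in Fin k. (1) If (i, false) and (j, false) lie in different orbits of the subgroup generated by b and θ, then the number of orbits of the subgroup generated by b and e_{ij} equals nc(b ∨ 1) − 1. (2) Suppose (i, false) and (j, false) lie in the same orbit of the subgroup generated by b and θ. If they lie in different orbits of the permutation b ∘ θ, then the number of orbits of the subgroup generated by b and e_{ij} equals nc(b ∨ 1) + 1; if they lie in the same orbit of b ∘ θ, then the number of orbits of the subgroup generated by b and τ_{ij} equals nc(b ∨ 1) + 1. -/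
open MulAction in
/-- The orbit relation of a generated group is contained in any equivalence relation that
is preserved pointwise by the generators. -/
theorem orbitRel_closure_le {V : Type*} {s : Set (Equiv.Perm V)} {r : Setoid V}
    (h : ∀ g ∈ s, ∀ v, r (g v) v) : orbitRel (Subgroup.closure s) V ≤ r := by
  intro u v huv
  obtain ⟨⟨g, hg⟩, rfl⟩ := orbitRel_apply.1 huv
  suffices ∀ v, r (g v) v from this v
  clear huv
  induction hg using Subgroup.closure_induction with
  | mem g hg => exact h g hg
  | one => exact r.refl
  | mul g g' _ _ ih ih' => exact fun v => r.trans (ih (g' v)) (ih' v)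
  | inv g _ ih => exact fun v => by simpa using r.symm (ih (g⁻¹ v))

open MulAction in
theorem orbitRel_closure_apply {V : Type*} {s : Set (Equiv.Perm V)} {g : Equiv.Perm V}
    (hg : g ∈ s) (v : V) : orbitRel (Subgroup.closure s) V (g v) v :=
  orbitRel_apply.2 ⟨⟨g, Subgroup.subset_closure hg⟩, rfl⟩

/-- Gluing two classes of an equivalence relation decreases the number of classes by one. -/
theorem Setoid.card_quotient_eq_add_one_of_glue {V : Type*} [Finite V] {r s : Setoid V} {p q : V}
    (hrs : r ≤ s) (hr : ¬ r p q) (hs : s p q)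
    (hsr : ∀ u v, s u v → r u v ∨ ((r u p ∨ r u q) ∧ (r v p ∨ r v q))) :
    Nat.card (Quotient r) = Nat.card (Quotient s) + 1 := by
  classical
  have hbij : Function.Bijective
      (fun a : {a : Quotient r // a ≠ Quotient.mk r q} =>
        Quotient.map' (s₁ := r) (s₂ := s) id (fun _ _ h => hrs h) a.1) := by
    constructor
    · rintro ⟨a, ha⟩ ⟨a', ha'⟩ h
      induction a using Quotient.inductionOn with | _ u
      induction a' using Quotient.inductionOn with | _ v
      have hu : ¬ r u q := fun h => ha (Quotient.sound h)
      have hv : ¬ r v q := fun h => ha' (Quotient.sound h)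
      have huv : s u v := Quotient.exact h
      refine Subtype.ext (Quotient.sound ?_)
      rcases hsr u v huv with h | ⟨h | h, h' | h'⟩
      · exact h
      · exact r.trans h (r.symm h')
      all_goals contradiction
    · intro a
      induction a using Quotient.inductionOn with | _ u
      by_cases hu : r u q
      · exact ⟨⟨Quotient.mk r p, fun h => hr (Quotient.exact h)⟩,
          Quotient.sound (s.trans hs (s.symm (hrs hu)))⟩
      · exact ⟨⟨Quotient.mk r u, fun h => hu (Quotient.exact h)⟩, rfl⟩
  rw [← Nat.card_congr (Equiv.ofBijective _ hbij)]
  have := Fintype.ofFinite (Quotient r)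
  have hpos : 0 < Fintype.card (Quotient r) := Fintype.card_pos_iff.2 ⟨Quotient.mk r q⟩
  simp only [Nat.card_eq_fintype_card, ne_eq, Fintype.card_subtype_compl,
    Fintype.card_unique]
  omega

/-- `c` is obtained from the involution `θ` by replacing the pairs `{p, θ p}` and `{q, θ q}`
with the pairs `{p, θ q}` and `{q, θ p}`. -/
structure IsReconnection_s10 {V : Type*} (θ c : Equiv.Perm V) (p q : V) : Prop where
  invol : ∀ v, θ (θ v) = v
  invol' : ∀ v, c (c v) = v
  apply_left : c p = θ q
  apply_right : c q = θ p
  apply_of_ne : ∀ v, v ≠ p → v ≠ q → v ≠ θ p → v ≠ θ q → c v = θ v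

namespace IsReconnection_s10

open MulAction

variable {V : Type*} {b θ c : Equiv.Perm V} {p q : V}

theorem symm (h : IsReconnection_s10 θ c p q) : IsReconnection_s10 c θ p q where
  invol := h.invol'
  invol' := h.invol
  apply_left := h.apply_right.symm
  apply_right := h.apply_left.symm
  apply_of_ne v h₁ h₂ h₃ h₄ :=
    (h.apply_of_ne v h₁ h₂ (h.apply_right ▸ h₄) (h.apply_left ▸ h₃)).symm

theorem apply_map_left (h : IsReconnection_s10 θ c p q) : c (θ p) = q := by
  rw [← h.apply_right, h.invol']

theorem apply_map_right (h : IsReconnection_s10 θ c p q) : c (θ q) = p := by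
  rw [← h.apply_left, h.invol']

/-- If `p` and `q` are related by `r`, which is compatible with `θ`, then `r` is compatible
with `c`. -/
theorem rel_apply (h : IsReconnection_s10 θ c p q) {r : Setoid V} (hθ : ∀ v, r (θ v) v)
    (hpq : r p q) (v : V) : r (c v) v := by
  by_cases h₁ : v = p
  · rw [h₁, h.apply_left]; exact r.trans (hθ q) (r.symm hpq)
  by_cases h₂ : v = q
  · rw [h₂, h.apply_right]; exact r.trans (hθ p) hpq
  by_cases h₃ : v = θ p
  · rw [h₃, h.apply_map_left]; exact r.symm (r.trans (hθ p) hpq)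
  by_cases h₄ : v = θ q
  · rw [h₄, h.apply_map_right]; exact r.trans hpq (r.symm (hθ q))
  rw [h.apply_of_ne v h₁ h₂ h₃ h₄]; exact hθ v

/-- A reconnection that joins two distinct orbits removes exactly one orbit. -/
theorem ncSet_eq_add_one [Finite V] (h : IsReconnection_s10 θ c p q)
    (hpq : ¬ orbitRel (Subgroup.closure {b, θ}) V p q)
    (hpq' : orbitRel (Subgroup.closure {b, c}) V p q) :
    ncSet {b, θ} = ncSet {b, c} + 1 := by
  set r := orbitRel (Subgroup.closure {b, θ}) V with hr
  have hb : ∀ v, r (b v) v := orbitRel_closure_apply (by simp)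
  have hθ : ∀ v, r (θ v) v := orbitRel_closure_apply (by simp)
  refine Setoid.card_quotient_eq_add_one_of_glue (p := p) (q := q) ?_ hpq hpq' ?_
  · refine orbitRel_closure_le ?_
    rintro g (rfl | rfl)
    · exact orbitRel_closure_apply (by simp)
    · exact h.symm.rel_apply (orbitRel_closure_apply (by simp)) hpq'
  · let t : Setoid V :=
      { r := fun u v => r u v ∨ ((r u p ∨ r u q) ∧ (r v p ∨ r v q))
        iseqv :=
          { refl := fun u => Or.inl (r.refl u)
            symm := by
              rintro u v (h | ⟨h, h'⟩)
              · exact Or.inl (r.symm h)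
              · exact Or.inr ⟨h', h⟩
            trans := by
              rintro u v w (h | ⟨h, h'⟩) (k | ⟨k, k'⟩)
              · exact Or.inl (r.trans h k)
              · exact Or.inr ⟨k.imp (r.trans h) (r.trans h), k'⟩
              · exact Or.inr ⟨h, h'.imp (r.trans (r.symm k)) (r.trans (r.symm k))⟩
              · exact Or.inr ⟨h, k'⟩ } }
    have ht : orbitRel (Subgroup.closure {b, c}) V ≤ t := by
      refine orbitRel_closure_le ?_
      rintro g (rfl | rfl)
      · exact fun v => Or.inl (hb v)
      · exact h.rel_apply (fun v => Or.inl (hθ v))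
          (Or.inr ⟨Or.inl (r.refl p), Or.inr (r.refl q)⟩)
    exact fun u v huv => ht huv

end IsReconnection_s10

section FixedPointFree

open MulAction

variable {V : Type*} {b θ c : Equiv.Perm V} {p q : V}

/-- The walk `u, b (θ u), …` never reaches the partner `θ u`. -/
theorem mul_pow_apply_ne (hb : ∀ v, b (b v) = v) (hb' : ∀ v, b v ≠ v)
    (hθ : ∀ v, θ (θ v) = v) (hθ' : ∀ v, θ v ≠ v) (n : ℕ) (u : V) :
    ((b * θ) ^ n) u ≠ θ u := by
  induction n using Nat.twoStepInduction generalizing u with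
  | zero => simpa using (hθ' u).symm
  | one => simpa using hb' (θ u)
  | more n ih _ =>
    intro h
    apply ih (b (θ u))
    rw [pow_succ', pow_succ] at h
    simp only [Equiv.Perm.mul_apply] at h
    have h' := congrArg (fun v => θ (b v)) h
    simpa only [hb, hθ] using h'

theorem orbitRel_of_sameCycle (h : (b * θ).SameCycle p q) :
    orbitRel (Subgroup.closure {b, θ}) V p q := by
  obtain ⟨n, rfl⟩ := h
  have hmem : b * θ ∈ Subgroup.closure {b, θ} :=
    mul_mem (Subgroup.subset_closure (by simp)) (Subgroup.subset_closure (by simp))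
  exact (orbitRel _ V).symm (orbitRel_apply.2 ⟨⟨_, zpow_mem hmem n⟩, rfl⟩)

/-- An orbit of the group generated by two involutions consists of at most two cycles of their
product, exchanged by either involution. -/
theorem sameCycle_or_of_orbitRel (hb : ∀ v, b (b v) = v) (hθ : ∀ v, θ (θ v) = v)
    (h : orbitRel (Subgroup.closure {b, θ}) V p q) :
    (b * θ).SameCycle p q ∨ (b * θ).SameCycle p (θ q) := by
  have hconj : θ * (b * θ) * θ⁻¹ = (b * θ)⁻¹ := by
    rw [← mul_assoc, mul_inv_cancel_right, mul_inv_rev, inv_eq_of_mul_eq_one_left (b := θ),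
      inv_eq_of_mul_eq_one_left (b := b)]
    · exact Equiv.ext hb
    · exact Equiv.ext hθ
  have key : ∀ u v, (b * θ).SameCycle u v → (b * θ).SameCycle (θ u) (θ v) := by
    intro u v huv
    have := huv.conj (g := θ)
    rwa [hconj, Equiv.Perm.sameCycle_inv] at this
  have key' : ∀ u v, (b * θ).SameCycle u (θ v) → (b * θ).SameCycle (θ u) v := by
    intro u v huv
    simpa [hθ] using key _ _ huv
  let t : Setoid V :=
    { r := fun u v => (b * θ).SameCycle u v ∨ (b * θ).SameCycle u (θ v)
      iseqv :=
        { refl := fun u => Or.inl (.refl _ u)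
          symm := by
            rintro u v (h | h)
            · exact Or.inl h.symm
            · exact Or.inr (key' _ _ h).symm
          trans := by
            rintro u v w (h | h) (k | k)
            · exact Or.inl (h.trans k)
            · exact Or.inr (h.trans k)
            · exact Or.inr (h.trans (key _ _ k))
            · exact Or.inl (h.trans (key' _ _ k)) } }
  have ht : orbitRel (Subgroup.closure {b, θ}) V ≤ t := by
    refine orbitRel_closure_le ?_
    rintro g (rfl | rfl) v
    · refine Or.inr (Equiv.Perm.SameCycle.symm ⟨1, ?_⟩)
      simp [hθ]
    · exact Or.inr (.refl _ _)
  exact ht h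

variable [Finite V]

theorem Equiv.Perm.SameCycle.exists_pow_eq_of_finite {f : Equiv.Perm V} (h : f.SameCycle p q) :
    ∃ n : ℕ, 0 < n ∧ (f ^ n) p = q := by
  obtain ⟨n, hn, -, h⟩ := h.exists_pow_eq''
  exact ⟨n, hn, h⟩

theorem not_sameCycle_mul_apply (hb : ∀ v, b (b v) = v) (hb' : ∀ v, b v ≠ v)
    (hθ : ∀ v, θ (θ v) = v) (hθ' : ∀ v, θ v ≠ v) (u : V) :
    ¬ (b * θ).SameCycle u (θ u) := fun h => by
  obtain ⟨n, -, h⟩ := h.exists_pow_eq_of_finite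
  exact mul_pow_apply_ne hb hb' hθ hθ' n u h

/-- Reconnecting points of two distinct orbits merges these orbits. -/
theorem IsReconnection_s10.orbitRel_of_not_orbitRel (h : IsReconnection_s10 θ c p q)
    (hb : ∀ v, b (b v) = v) (hb' : ∀ v, b v ≠ v) (hθ' : ∀ v, θ v ≠ v)
    (hpq : ¬ orbitRel (Subgroup.closure {b, θ}) V p q) :
    orbitRel (Subgroup.closure {b, c}) V p q := by
  set r := orbitRel (Subgroup.closure {b, c}) V
  have hrb : ∀ v, r (b v) v := orbitRel_closure_apply (by simp)
  have hrc : ∀ v, r (c v) v := orbitRel_closure_apply (by simp)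
  have hθq : orbitRel (Subgroup.closure {b, θ}) V (θ q) q := orbitRel_closure_apply (by simp) q
  have hpθ : r (θ p) q := r.symm (h.apply_map_left ▸ hrc (θ p))
  have step : ∀ n : ℕ, r (((b * θ) ^ (n + 1)) p) q := by
    intro n
    induction n with
    | zero => simpa using r.trans (hrb (θ p)) hpθ
    | succ n ih =>
      have hcyc : (b * θ).SameCycle p (((b * θ) ^ (n + 1)) p) := ⟨(n + 1 : ℕ), by rw [zpow_natCast]⟩
      have hz := mul_pow_apply_ne hb hb' h.invol hθ' (n + 1) p
      rw [pow_succ' _ (n + 1), Equiv.Perm.mul_apply]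
      generalize ((b * θ) ^ (n + 1)) p = z at *
      rw [Equiv.Perm.mul_apply]
      refine r.trans (hrb (θ z)) ?_
      have hpz := orbitRel_of_sameCycle hcyc
      by_cases hzp : z = p
      · rwa [hzp]
      have hzq : z ≠ q := by rintro rfl; exact hpq hpz
      have hzq' : z ≠ θ q := by rintro rfl; exact hpq (Setoid.trans' _ hpz hθq)
      rw [← h.apply_of_ne z hzp hzq hz hzq']
      exact r.trans (hrc z) ih
  obtain ⟨n, hn, hnp⟩ := (Equiv.Perm.SameCycle.refl (b * θ) p).exists_pow_eq_of_finite
  obtain ⟨m, rfl⟩ := Nat.exists_eq_succ_of_ne_zero hn.ne'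
  simpa only [Nat.succ_eq_add_one, hnp] using step m

/-- Reconnecting two points of the same cycle of `b * θ` separates them. -/
theorem IsReconnection_s10.not_orbitRel_of_sameCycle (h : IsReconnection_s10 θ c p q)
    (hb : ∀ v, b (b v) = v) (hb' : ∀ v, b v ≠ v) (hθ' : ∀ v, θ v ≠ v) (hne : p ≠ q)
    (hpq : (b * θ).SameCycle p q) :
    ¬ orbitRel (Subgroup.closure {b, c}) V p q := by
  classical
  set f := b * θ with hf
  have hfv : ∀ v, f v = b (θ v) := fun v => rfl
  have hex := hpq.exists_pow_eq_of_finite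
  obtain ⟨hn, hnq⟩ := Nat.find_spec hex
  have hmin : ∀ m, 0 < m → m < Nat.find hex → (f ^ m) p ≠ q :=
    fun m hm hlt hmq => Nat.find_min hex hlt ⟨hm, hmq⟩
  generalize Nat.find hex = n at *
  have hnp : ∀ m, 0 < m → m ≤ n → (f ^ m) p ≠ p := by
    intro m hm hmn hmp
    rcases hmn.eq_or_lt with rfl | hmn
    · exact hne (hmp.symm.trans hnq)
    · refine hmin (n - m) (by omega) (by omega) ?_
      rw [← hnq]
      nth_rw 2 [← Nat.sub_add_cancel hmn.le]
      rw [pow_add, Equiv.Perm.mul_apply, hmp]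
  have hcyc : ∀ m : ℕ, f.SameCycle p ((f ^ m) p) := fun m => ⟨m, by simp⟩
  have hθp : ∀ m : ℕ, (f ^ m) p ≠ θ p := fun m =>
    mul_pow_apply_ne hb hb' h.invol hθ' m p
  have hθq : ∀ m : ℕ, (f ^ m) p ≠ θ q := fun m hm =>
    not_sameCycle_mul_apply hb hb' h.invol hθ' q (hpq.symm.trans (hm ▸ hcyc m))
  have hsucc : ∀ m : ℕ, b (θ ((f ^ m) p)) = (f ^ (m + 1)) p := fun m => by
    rw [pow_succ', Equiv.Perm.mul_apply, hfv]
  have hpred : ∀ m : ℕ, b ((f ^ (m + 1)) p) = θ ((f ^ m) p) := fun m => by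
    rw [← hsucc, hb]
  have hc : ∀ m, 0 < m → m < n → c ((f ^ m) p) = θ ((f ^ m) p) := fun m hm hmn =>
    h.apply_of_ne _ (hnp m hm hmn.le) (hmin m hm hmn) (hθp m) (hθq m)
  -- the arc of the orbit from `θ p` to `q`
  let A : Set V := {v | ∃ m < n, v = (f ^ (m + 1)) p ∨ v = θ ((f ^ m) p)}
  have hAb : ∀ v ∈ A, b v ∈ A := by
    rintro v ⟨m, hm, rfl | rfl⟩
    · exact ⟨m, hm, Or.inr (hpred m)⟩
    · exact ⟨m, hm, Or.inl (hsucc m)⟩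
  have hAc : ∀ v ∈ A, c v ∈ A := by
    rintro v ⟨m, hm, rfl | rfl⟩
    · rcases (Nat.succ_le_of_lt hm).eq_or_lt with rfl | hlt
      · refine ⟨0, hn, Or.inr ?_⟩
        rw [hnq, h.apply_right]; simp
      · exact ⟨m + 1, hlt, Or.inr (hc _ m.succ_pos hlt)⟩
    · rcases m.eq_zero_or_pos with rfl | hpos
      · obtain ⟨k, rfl⟩ := Nat.exists_eq_succ_of_ne_zero hn.ne'
        refine ⟨k, k.lt_succ_self, Or.inl ?_⟩
        rw [hnq, pow_zero, Equiv.Perm.one_apply, h.apply_map_left]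
      · obtain ⟨k, rfl⟩ := Nat.exists_eq_succ_of_ne_zero hpos.ne'
        refine ⟨k, by omega, Or.inl ?_⟩
        rw [← hc _ hpos hm, h.invol']
  have hle : orbitRel (Subgroup.closure {b, c}) V ≤ Setoid.ker (· ∈ A) := by
    refine orbitRel_closure_le ?_
    rintro g (rfl | rfl) v
    · exact propext ⟨fun hv => hb v ▸ hAb _ hv, hAb v⟩
    · exact propext ⟨fun hv => h.invol' v ▸ hAc _ hv, hAc v⟩
  intro hcon
  have hqA : q ∈ A := by
    obtain ⟨k, rfl⟩ := Nat.exists_eq_succ_of_ne_zero hn.ne'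
    exact ⟨k, k.lt_succ_self, Or.inl hnq.symm⟩
  have hpA : p ∈ A := (show (p ∈ A) = (q ∈ A) from hle hcon).mpr hqA
  obtain ⟨m, hm, hpm | hpm⟩ := hpA
  · exact hnp (m + 1) m.succ_pos hm hpm.symm
  · exact hθp m ((h.invol _).symm.trans (congrArg θ hpm.symm))

/-- Reconnecting points of distinct orbits removes one orbit. -/
theorem IsReconnection_s10.ncSet_eq_sub_one (h : IsReconnection_s10 θ c p q)
    (hb : ∀ v, b (b v) = v) (hb' : ∀ v, b v ≠ v) (hθ' : ∀ v, θ v ≠ v)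
    (hpq : ¬ orbitRel (Subgroup.closure {b, θ}) V p q) :
    ncSet {b, c} = ncSet {b, θ} - 1 := by
  rw [h.ncSet_eq_add_one hpq (h.orbitRel_of_not_orbitRel hb hb' hθ' hpq), Nat.add_sub_cancel]

/-- Reconnecting two points of the same cycle of `b * θ` creates one orbit. -/
theorem IsReconnection_s10.ncSet_eq_add_one_of_sameCycle (h : IsReconnection_s10 θ c p q)
    (hb : ∀ v, b (b v) = v) (hb' : ∀ v, b v ≠ v) (hθ' : ∀ v, θ v ≠ v) (hne : p ≠ q)
    (hpq : (b * θ).SameCycle p q) :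
    ncSet {b, c} = ncSet {b, θ} + 1 :=
  h.symm.ncSet_eq_add_one (h.not_orbitRel_of_sameCycle hb hb' hθ' hne hpq)
    (orbitRel_of_sameCycle hpq)

end FixedPointFree

/-- Cycle creation/deletion when multiplying a Brauer diagram `b` by an
elementary diagram: if `(i,false)` and `(j,false)` lie in different cycles of
`b` then `nc(e_{ij} ∨ b) = nc(b ∨ 1) - 1`; if they lie in the same cycle then
the projector (resp. transposition) diagram creates a cycle according to the
relative orientation, i.e. according to whether `(i,false)` and `(j,false)` lie
in different (resp. the same) orbits of the permutation `b ∘ θ`. -/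
theorem stmt10 (k : ℕ) (hk : 1 ≤ k)
    (θ b e τ : Equiv.Perm (Fin k × Bool)) (i j : Fin k) (hij : i ≠ j)
    (hθ : ∀ v, θ v = (v.1, !v.2))
    (hbinv : ∀ v, b (b v) = v) (hbfree : ∀ v, b v ≠ v)
    (he : ∀ (x : Fin k) (ε : Bool),
      e (x, ε) = if x = i then (j, ε) else if x = j then (i, ε) else (x, !ε))
    (hτ : ∀ (x : Fin k) (ε : Bool),
      τ (x, ε) = if x = i then (j, !ε) else if x = j then (i, !ε) else (x, !ε)) :
    ((((i, false) : Fin k × Bool)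
        ∉ MulAction.orbit (Subgroup.closure ({b, θ} : Set (Equiv.Perm (Fin k × Bool))))
            (((j, false)) : Fin k × Bool) →
      ncSet ({b, e} : Set (Equiv.Perm (Fin k × Bool)))
        = ncSet ({b, θ} : Set (Equiv.Perm (Fin k × Bool))) - 1)) ∧
    ((((i, false) : Fin k × Bool)
        ∈ MulAction.orbit (Subgroup.closure ({b, θ} : Set (Equiv.Perm (Fin k × Bool))))
            (((j, false)) : Fin k × Bool) →
      ((¬ (b * θ).SameCycle (i, false) (j, false) →
          ncSet ({b, e} : Set (Equiv.Perm (Fin k × Bool)))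
            = ncSet ({b, θ} : Set (Equiv.Perm (Fin k × Bool))) + 1) ∧
        ((b * θ).SameCycle (i, false) (j, false) →
          ncSet ({b, τ} : Set (Equiv.Perm (Fin k × Bool)))
            = ncSet ({b, θ} : Set (Equiv.Perm (Fin k × Bool))) + 1)))) := by
  have hθθ : ∀ v, θ (θ v) = v := fun v => by simp [hθ]
  have hθ' : ∀ v, θ v ≠ v := fun v h => by
    have := congrArg Prod.snd h
    simp [hθ] at this
  have hji := hij.symm
  have hre : IsReconnection_s10 θ e (i, false) (j, true) := by
    refine ⟨hθθ, ?_, ?_, ?_, ?_⟩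
    · rintro ⟨x, ε⟩
      simp only [he]
      split_ifs <;> simp_all
    · simp [he, hθ]
    · simp [he, hθ, hji]
    · rintro ⟨x, _ | _⟩ <;> simp [he, hθ] <;> grind
  have hrτ : IsReconnection_s10 θ τ (i, false) (j, false) := by
    refine ⟨hθθ, ?_, ?_, ?_, ?_⟩
    · rintro ⟨x, ε⟩
      simp only [hτ]
      split_ifs <;> simp_all
    · simp [hτ, hθ]
    · simp [hτ, hθ, hji]
    · rintro ⟨x, _ | _⟩ <;> simp [hτ, hθ] <;> grind
  have hθj : θ (j, false) = (j, true) := hθ _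
  refine ⟨fun h => hre.ncSet_eq_sub_one hbinv hbfree hθ' fun h' => h ?_, fun h =>
    ⟨fun hc => ?_, hrτ.ncSet_eq_add_one_of_sameCycle hbinv hbfree hθ' (by simp [hij])⟩⟩
  · refine MulAction.orbitRel_apply.1 (Setoid.trans' _ h' ?_)
    rw [← hθj]
    exact orbitRel_closure_apply (by simp) _
  · refine hre.ncSet_eq_add_one_of_sameCycle hbinv hbfree hθ' (by simp [hij]) ?_
    rw [← hθj]
    exact (sameCycle_or_of_orbitRel hbinv hθθ (MulAction.orbitRel_apply.2 h)).resolve_left hc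
end

section
/- Let α be a finite type with cardinality ℓ ≥ 2 and let σ be a permutation of α that is a single ℓ-cycle (the cyclic group generated by σ acts transitively on α). Then the number of (ℓ−1)-tuples (τ_1, …, τ_{ℓ−1}) of transpositions of α with τ_1 ∘ τ_2 ∘ ⋯ ∘ τ_{ℓ−1} = σ equals ℓ^{ℓ−2}. -/
open Finset

namespace Equiv.Perm

section SameCycle

variable {α : Type*} {π : Perm α} {a b x y : α}

theorem equivalence_sameCycle (π : Perm α) : Equivalence π.SameCycle :=
  ⟨SameCycle.refl π, SameCycle.symm, SameCycle.trans⟩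

theorem sameCycle_mul_swap_iff_swap_mul_inv [DecidableEq α] :
    (π * swap a b).SameCycle x y ↔ (swap a b * π⁻¹).SameCycle x y := by
  rw [← sameCycle_inv, mul_inv_rev, swap_inv]

variable [Finite α]

/-- A relation that is preserved along a permutation contains the cycles of the permutation. -/
theorem SameCycle.of_forall_apply {r : α → α → Prop} (hr : Equivalence r)
    (h : ∀ x, r x (π x)) (hxy : π.SameCycle x y) : r x y := by
  obtain ⟨n, rfl⟩ := hxy.exists_nat_pow_eq
  clear hxy
  induction n with
  | zero => exact hr.refl _
  | succ n ih =>
    rw [pow_succ', mul_apply]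
    exact hr.trans ih (h _)

variable [DecidableEq α]

theorem SameCycle.of_mul_swap (hab : π.SameCycle a b) (h : (π * swap a b).SameCycle x y) :
    π.SameCycle x y := by
  refine SameCycle.of_forall_apply (equivalence_sameCycle π) (fun z => ?_) h
  rw [mul_apply, sameCycle_apply_right]
  by_cases hza : z = a
  · subst hza; simpa using hab
  by_cases hzb : z = b
  · subst hzb; simpa using hab.symm
  · rw [swap_apply_of_ne_of_ne hza hzb]

theorem sameCycle_swap_mul_of_sameCycle_left (hab : ¬ π.SameCycle a b) (h : π.SameCycle a x) :
    (swap a b * π).SameCycle a x := by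
  obtain ⟨n, rfl⟩ := h.exists_nat_pow_eq
  clear h
  induction n with
  | zero => exact SameCycle.refl _ _
  | succ n ih =>
    by_cases ha : (π ^ (n + 1)) a = a
    · rw [ha]
    · have hb : (π ^ (n + 1)) a ≠ b := fun h => hab ⟨(n + 1 : ℕ), by exact_mod_cast h⟩
      have := sameCycle_apply_right.2 ih
      rwa [mul_apply, ← mul_apply π, ← pow_succ', swap_apply_of_ne_of_ne ha hb] at this

theorem sameCycle_swap_mul_of_not_sameCycle (ha : ¬ π.SameCycle a x) (hb : ¬ π.SameCycle b x)
    (h : π.SameCycle x y) : (swap a b * π).SameCycle x y := by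
  obtain ⟨n, rfl⟩ := h.exists_nat_pow_eq
  clear h
  induction n with
  | zero => exact SameCycle.refl _ _
  | succ n ih =>
    have ha' : (π ^ (n + 1)) x ≠ a := fun h =>
      ha (SameCycle.symm ⟨(n + 1 : ℕ), by exact_mod_cast h⟩)
    have hb' : (π ^ (n + 1)) x ≠ b := fun h =>
      hb (SameCycle.symm ⟨(n + 1 : ℕ), by exact_mod_cast h⟩)
    have := sameCycle_apply_right.2 ih
    rwa [mul_apply, ← mul_apply π, ← pow_succ', swap_apply_of_ne_of_ne ha' hb'] at this

theorem sameCycle_swap_mul_self (hab : ¬ π.SameCycle a b) : (swap a b * π).SameCycle a b := by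
  have h : (swap a b * π).SameCycle a (π⁻¹ a) :=
    sameCycle_swap_mul_of_sameCycle_left hab (sameCycle_symm_apply_right.2 (SameCycle.refl _ _))
  have := sameCycle_apply_right.2 h
  simpa using this

/-- Multiplying by a transposition of points in different cycles merges these cycles and leaves
the other ones alone. -/
theorem sameCycle_swap_mul_iff (hab : ¬ π.SameCycle a b) :
    (swap a b * π).SameCycle x y ↔ π.SameCycle x y ∨
      ((π.SameCycle a x ∨ π.SameCycle b x) ∧ (π.SameCycle a y ∨ π.SameCycle b y)) := by
  have hba : ¬ π.SameCycle b a := fun h => hab h.symm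
  have key : ∀ z, π.SameCycle a z ∨ π.SameCycle b z → (swap a b * π).SameCycle a z := by
    rintro z (hz | hz)
    · exact sameCycle_swap_mul_of_sameCycle_left hab hz
    · refine (sameCycle_swap_mul_self hab).trans ?_
      rw [swap_comm]
      exact sameCycle_swap_mul_of_sameCycle_left hba hz
  constructor
  · intro h
    refine SameCycle.of_forall_apply (r := fun x y => π.SameCycle x y ∨
      ((π.SameCycle a x ∨ π.SameCycle b x) ∧ (π.SameCycle a y ∨ π.SameCycle b y)))
      ⟨fun z => Or.inl (SameCycle.refl _ _), ?_, ?_⟩ (fun z => ?_) h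
    · rintro z w (h | h)
      · exact Or.inl h.symm
      · exact Or.inr h.symm
    · rintro z w v (h | h) (h' | h')
      · exact Or.inl (h.trans h')
      · exact Or.inr ⟨h'.1.imp (·.trans h.symm) (·.trans h.symm), h'.2⟩
      · exact Or.inr ⟨h.1, h.2.imp (·.trans h') (·.trans h')⟩
      · exact Or.inr ⟨h.1, h'.2⟩
    · rw [mul_apply]
      by_cases hza : π z = a
      · have h1 : π.SameCycle a z := by simp [← hza, SameCycle.refl]
        rw [hza, swap_apply_left]
        exact Or.inr ⟨Or.inl h1, Or.inr (SameCycle.refl _ _)⟩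
      by_cases hzb : π z = b
      · have h1 : π.SameCycle b z := by simp [← hzb, SameCycle.refl]
        rw [hzb, swap_apply_right]
        exact Or.inr ⟨Or.inr h1, Or.inl (SameCycle.refl _ _)⟩
      · rw [swap_apply_of_ne_of_ne hza hzb]
        exact Or.inl (by simp [SameCycle.refl])
  · rintro (h | ⟨hx, hy⟩)
    · by_cases hx : π.SameCycle a x ∨ π.SameCycle b x
      · have hy := hx.imp (·.trans h) (·.trans h)
        exact (key x hx).symm.trans (key y hy)
      · rw [not_or] at hx
        exact sameCycle_swap_mul_of_not_sameCycle hx.1 hx.2 h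
    · exact (key x hx).symm.trans (key y hy)

theorem sameCycle_mul_swap_iff (hab : ¬ π.SameCycle a b) :
    (π * swap a b).SameCycle x y ↔ π.SameCycle x y ∨
      ((π.SameCycle a x ∨ π.SameCycle b x) ∧ (π.SameCycle a y ∨ π.SameCycle b y)) := by
  rw [sameCycle_mul_swap_iff_swap_mul_inv, sameCycle_swap_mul_iff (by rwa [sameCycle_inv])]
  simp only [sameCycle_inv]

end SameCycle

section Orbits

variable {α : Type*} [Fintype α] [DecidableEq α] {π : Perm α} {a b x y : α}

/-- The set of points in the cycle of `a` under `π`. -/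
def orbitOf (π : Perm α) (a : α) : Finset α := {x | π.SameCycle a x}

/-- The set of cycles of `π`, fixed points included, as sets of points. -/
def orbits (π : Perm α) : Finset (Finset α) := univ.image π.orbitOf

@[simp]
theorem mem_orbitOf : x ∈ π.orbitOf a ↔ π.SameCycle a x := by simp [orbitOf]

theorem orbitOf_eq_orbitOf : π.orbitOf a = π.orbitOf b ↔ π.SameCycle a b := by
  constructor
  · intro h
    rw [← mem_orbitOf, h, mem_orbitOf]
  · intro h
    ext x
    simp only [mem_orbitOf]
    exact ⟨h.symm.trans, h.trans⟩

theorem orbitOf_mem_orbits : π.orbitOf a ∈ π.orbits := mem_image_of_mem _ (mem_univ a)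

theorem card_orbitOf_pos : 0 < #(π.orbitOf a) :=
  card_pos.2 ⟨a, mem_orbitOf.2 (SameCycle.refl _ _)⟩

theorem sum_inv_card_orbitOf (π : Perm α) : ∑ a, (#(π.orbitOf a) : ℚ)⁻¹ = #π.orbits := by
  rw [Finset.sum_comp (fun B : Finset α => (#B : ℚ)⁻¹) π.orbitOf, card_eq_sum_ones, Nat.cast_sum]
  refine sum_congr rfl fun B hB => ?_
  obtain ⟨a, -, rfl⟩ := mem_image.1 hB
  have : ({x | π.orbitOf x = π.orbitOf a} : Finset α) = π.orbitOf a := by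
    ext x
    simp [orbitOf_eq_orbitOf, sameCycle_comm]
  rw [this, nsmul_eq_mul, Nat.cast_one]
  exact mul_inv_cancel₀ (by exact_mod_cast card_orbitOf_pos.ne')

theorem card_orbits_le_card_orbits_mul_swap (hab : π.SameCycle a b) :
    #π.orbits ≤ #(π * swap a b).orbits := by
  have : π.orbits = (π * swap a b).orbits.image (fun B => B.biUnion π.orbitOf) := by
    rw [orbits, orbits, image_image]
    refine image_congr fun x _ => ?_
    ext y
    simp only [Function.comp_apply, mem_biUnion, mem_orbitOf]
    exact ⟨fun h => ⟨x, SameCycle.refl _ _, h⟩, fun ⟨z, hz, h⟩ => (hab.of_mul_swap hz).trans h⟩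
  rw [this]
  exact card_image_le

theorem orbits_mul_swap (hab : ¬ π.SameCycle a b) :
    (π * swap a b).orbits = insert (π.orbitOf a ∪ π.orbitOf b)
      ((π.orbits.erase (π.orbitOf a)).erase (π.orbitOf b)) := by
  have h1 : ∀ x, π.SameCycle a x ∨ π.SameCycle b x →
      (π * swap a b).orbitOf x = π.orbitOf a ∪ π.orbitOf b := by
    intro x hx
    ext y
    simp only [mem_orbitOf, mem_union, sameCycle_mul_swap_iff hab, hx, true_and, or_iff_right_iff_imp]
    exact fun h => hx.imp (·.trans h) (·.trans h)
  have h2 : ∀ x, ¬ (π.SameCycle a x ∨ π.SameCycle b x) →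
      (π * swap a b).orbitOf x = π.orbitOf x := by
    intro x hx
    ext y
    simp only [mem_orbitOf, sameCycle_mul_swap_iff hab, hx, false_and, or_false]
  ext B
  simp only [mem_insert, mem_erase]
  constructor
  · intro hB
    obtain ⟨x, -, rfl⟩ := mem_image.1 hB
    by_cases hx : π.SameCycle a x ∨ π.SameCycle b x
    · exact Or.inl (h1 x hx)
    · rw [h2 x hx]
      rw [not_or] at hx
      exact Or.inr ⟨fun h => hx.2 (orbitOf_eq_orbitOf.1 h.symm),
        fun h => hx.1 (orbitOf_eq_orbitOf.1 h.symm), orbitOf_mem_orbits⟩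
  · rintro (rfl | ⟨hb, ha, hB⟩)
    · rw [← h1 a (Or.inl (SameCycle.refl _ _))]
      exact orbitOf_mem_orbits
    · obtain ⟨x, -, rfl⟩ := mem_image.1 hB
      rw [← h2 x]
      · exact orbitOf_mem_orbits
      · rintro (h | h)
        · exact ha (orbitOf_eq_orbitOf.2 h.symm)
        · exact hb (orbitOf_eq_orbitOf.2 h.symm)

theorem orbitOf_union_notMem_orbits (hab : ¬ π.SameCycle a b) :
    π.orbitOf a ∪ π.orbitOf b ∉ π.orbits := by
  intro h
  obtain ⟨x, -, hx⟩ := mem_image.1 h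
  have ha : a ∈ π.orbitOf x := by simp [hx, SameCycle.refl]
  have hb : b ∈ π.orbitOf x := by simp [hx, SameCycle.refl]
  exact hab ((mem_orbitOf.1 ha).symm.trans (mem_orbitOf.1 hb))

theorem card_orbits_mul_swap (hab : ¬ π.SameCycle a b) :
    #(π * swap a b).orbits + 1 = #π.orbits := by
  have hne : π.orbitOf b ≠ π.orbitOf a := fun h => hab (orbitOf_eq_orbitOf.1 h.symm)
  rw [orbits_mul_swap hab, card_insert_of_notMem, card_erase_add_one, card_erase_add_one]
  · exact orbitOf_mem_orbits
  · exact mem_erase.2 ⟨hne, orbitOf_mem_orbits⟩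
  · exact fun h => orbitOf_union_notMem_orbits hab (mem_of_mem_erase (mem_of_mem_erase h))

theorem prod_card_orbits_mul_swap (hab : ¬ π.SameCycle a b) :
    (∏ B ∈ (π * swap a b).orbits, (#B : ℚ)) =
      (∏ B ∈ π.orbits, (#B : ℚ)) * ((#(π.orbitOf a) : ℚ)⁻¹ + (#(π.orbitOf b) : ℚ)⁻¹) := by
  have hne : π.orbitOf b ≠ π.orbitOf a := fun h => hab (orbitOf_eq_orbitOf.1 h.symm)
  have ha : (#(π.orbitOf a) : ℚ) ≠ 0 := by exact_mod_cast card_orbitOf_pos.ne'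
  have hb : (#(π.orbitOf b) : ℚ) ≠ 0 := by exact_mod_cast card_orbitOf_pos.ne'
  have hdisj : _root_.Disjoint (π.orbitOf a) (π.orbitOf b) := by
    rw [Finset.disjoint_left]
    intro x hx hx'
    exact hab ((mem_orbitOf.1 hx).trans (mem_orbitOf.1 hx').symm)
  rw [orbits_mul_swap hab, prod_insert, card_union_of_disjoint hdisj,
    ← mul_prod_erase π.orbits _ (orbitOf_mem_orbits (a := a)),
    ← mul_prod_erase (π.orbits.erase _) _ (mem_erase.2 ⟨hne, orbitOf_mem_orbits⟩)]
  · push_cast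
    field_simp
    ring
  · exact fun h => orbitOf_union_notMem_orbits hab (mem_of_mem_erase (mem_of_mem_erase h))

theorem sum_not_sameCycle_inv_card (π : Perm α) :
    ∑ a, ∑ b, (if π.SameCycle a b then 0
        else (#(π.orbitOf a) : ℚ)⁻¹ + (#(π.orbitOf b) : ℚ)⁻¹) =
      2 * (Fintype.card α * (#π.orbits - 1)) := by
  have key : ∑ a, ∑ b, (if π.SameCycle a b then 0 else (#(π.orbitOf a) : ℚ)⁻¹) =
      Fintype.card α * (#π.orbits - 1) := by
    have : ∀ a, ∑ b, (if π.SameCycle a b then 0 else (#(π.orbitOf a) : ℚ)⁻¹) =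
        Fintype.card α * (#(π.orbitOf a) : ℚ)⁻¹ - 1 := by
      intro a
      have h0 : (#(π.orbitOf a) : ℚ) ≠ 0 := by exact_mod_cast card_orbitOf_pos.ne'
      have h1 : ∀ b, (if π.SameCycle a b then 0 else (#(π.orbitOf a) : ℚ)⁻¹) =
          (#(π.orbitOf a) : ℚ)⁻¹ - if π.SameCycle a b then (#(π.orbitOf a) : ℚ)⁻¹ else 0 := by
        intro b; split_ifs <;> simp
      simp_rw [h1]
      rw [sum_sub_distrib, ← sum_filter, sum_const, sum_const, nsmul_eq_mul, nsmul_eq_mul]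
      change _ - (#(π.orbitOf a) : ℚ) * _ = _
      rw [mul_inv_cancel₀ h0, card_univ]
    simp_rw [this]
    rw [sum_sub_distrib, ← mul_sum, sum_inv_card_orbitOf, sum_const, card_univ, nsmul_eq_mul]
    ring
  have split : ∀ a b, (if π.SameCycle a b then 0
        else (#(π.orbitOf a) : ℚ)⁻¹ + (#(π.orbitOf b) : ℚ)⁻¹) =
      (if π.SameCycle a b then 0 else (#(π.orbitOf a) : ℚ)⁻¹) +
        (if π.SameCycle b a then 0 else (#(π.orbitOf b) : ℚ)⁻¹) := by
    intro a b
    by_cases h : π.SameCycle a b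
    · simp [h, h.symm]
    · simp [h, mt SameCycle.symm h]
  simp_rw [split, sum_add_distrib]
  rw [key, sum_comm, key]
  ring

end Orbits

section Swaps

variable {α : Type*} [DecidableEq α]

theorem IsSwap.conj {τ : Perm α} (h : τ.IsSwap) (g : Perm α) : (g * τ * g⁻¹).IsSwap := by
  obtain ⟨x, y, hxy, rfl⟩ := h
  exact ⟨g x, g y, g.injective.ne hxy, by rw [mul_swap_eq_swap_mul, mul_inv_cancel_right]⟩

theorem swap_eq_swap_iff_of_ne {a b x y : α} (hxy : x ≠ y) :
    swap a b = swap x y ↔ (a = x ∧ b = y) ∨ (a = y ∧ b = x) := by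
  constructor
  · intro h
    have h1 : swap a b x = y := by rw [h, swap_apply_left]
    rw [swap_apply_def] at h1
    split_ifs at h1 <;> grind
  · rintro (⟨rfl, rfl⟩ | ⟨rfl, rfl⟩)
    · rfl
    · exact swap_comm _ _

variable [Fintype α]

/-- The set of all transpositions. -/
def swaps (α : Type*) [Fintype α] [DecidableEq α] : Finset (Perm α) :=
  (univ : Finset α).offDiag.image fun p => swap p.1 p.2

@[simp]
theorem mem_swaps {τ : Perm α} : τ ∈ swaps α ↔ τ.IsSwap := by
  simp only [swaps, mem_image, mem_offDiag, mem_univ, true_and, Prod.exists, IsSwap, eq_comm]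

theorem sum_offDiag_swap (f : Perm α → ℚ) :
    ∑ p ∈ (univ : Finset α).offDiag, f (swap p.1 p.2) = 2 * ∑ τ ∈ swaps α, f τ := by
  rw [Finset.sum_comp f (fun p : α × α => swap p.1 p.2), mul_sum]
  refine sum_congr rfl fun τ hτ => ?_
  obtain ⟨x, y, hxy, rfl⟩ := mem_swaps.1 hτ
  have : {p ∈ (univ : Finset α).offDiag | swap p.1 p.2 = swap x y} = {(x, y), (y, x)} := by
    ext ⟨a, b⟩
    simp only [mem_filter, mem_offDiag, swap_eq_swap_iff_of_ne hxy, mem_insert, mem_singleton,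
      Prod.mk.injEq]
    grind
  rw [this, card_pair (by simp [hxy]), nsmul_eq_mul]
  norm_num

/-- The number of factorizations of `ρ` into a product of `k` transpositions. -/
def numSwapFactorizations : ℕ → Perm α → ℕ
  | 0, ρ => if ρ = 1 then 1 else 0
  | k + 1, ρ => ∑ τ ∈ swaps α, numSwapFactorizations k (τ⁻¹ * ρ)

theorem natCard_swapFactorizations (k : ℕ) (ρ : Perm α) :
    Nat.card {L : List (Perm α) // L.length = k ∧ (∀ τ ∈ L, τ.IsSwap) ∧ L.prod = ρ} =
      numSwapFactorizations k ρ := by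
  induction k generalizing ρ with
  | zero =>
    rw [numSwapFactorizations]
    split_ifs with h
    · subst h
      rw [Nat.card_eq_one_iff_unique]
      refine ⟨⟨fun L M => Subtype.ext ?_⟩, ⟨⟨[], by simp⟩⟩⟩
      rw [List.length_eq_zero_iff.1 L.2.1, List.length_eq_zero_iff.1 M.2.1]
    · rw [Nat.card_eq_zero]
      refine Or.inl ⟨fun L => h ?_⟩
      rw [← L.2.2.2, List.length_eq_zero_iff.1 L.2.1, List.prod_nil]
  | succ k ih =>
    have hfin : ∀ ρ : Perm α, Finite {L : List (Perm α) //
        L.length = k ∧ (∀ τ ∈ L, τ.IsSwap) ∧ L.prod = ρ} := fun ρ =>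
      ((List.finite_length_eq (Perm α) k).subset fun L hL => hL.1).to_subtype
    let e : {L : List (Perm α) // L.length = k + 1 ∧ (∀ τ ∈ L, τ.IsSwap) ∧ L.prod = ρ} ≃
        Σ τ : swaps α, {L : List (Perm α) //
          L.length = k ∧ (∀ τ ∈ L, τ.IsSwap) ∧ L.prod = (τ : Perm α)⁻¹ * ρ} :=
      { toFun := fun
          | ⟨[], h⟩ => by simp at h
          | ⟨τ :: L, h⟩ => ⟨⟨τ, mem_swaps.2 (h.2.1 τ (by simp))⟩, ⟨L, by simpa using h.1,
              fun τ' hτ' => h.2.1 τ' (by simp [hτ']), eq_inv_mul_iff_mul_eq.2 (by simpa using h.2.2)⟩⟩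
        invFun := fun x => ⟨x.1 :: x.2.1, by simp [x.2.2.1], by
            have := mem_swaps.1 x.1.2
            have := x.2.2.2.1
            simp_all, by simp [x.2.2.2.2]⟩
        left_inv := fun
          | ⟨[], h⟩ => by simp at h
          | ⟨τ :: L, h⟩ => rfl
        right_inv := fun _ => rfl }
    rw [Nat.card_congr e, Nat.card_sigma, numSwapFactorizations]
    simp_rw [ih]
    exact sum_coe_sort (swaps α) fun τ => numSwapFactorizations k (τ⁻¹ * ρ)

theorem numSwapFactorizations_conj (k : ℕ) (g ρ : Perm α) :
    numSwapFactorizations k (g * ρ * g⁻¹) = numSwapFactorizations k ρ := by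
  induction k generalizing ρ with
  | zero => simp [numSwapFactorizations, mul_inv_eq_one]
  | succ k ih =>
    rw [numSwapFactorizations, numSwapFactorizations]
    refine (sum_nbij' (fun τ => g * τ * g⁻¹) (fun τ => g⁻¹ * τ * g) ?_ ?_ ?_ ?_ ?_).symm
    · exact fun τ hτ => mem_swaps.2 ((mem_swaps.1 hτ).conj g)
    · exact fun τ hτ => mem_swaps.2 (by simpa using (mem_swaps.1 hτ).conj g⁻¹)
    · intro τ _; group
    · intro τ _; group
    · intro τ _
      rw [← ih]
      congr 1
      group

end Swaps

section FullCycles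

variable {α : Type*} [Fintype α] [DecidableEq α]

/-- The set of permutations that act transitively. -/
def fullCycles (α : Type*) [Fintype α] [DecidableEq α] : Finset (Perm α) :=
  {σ | ∀ x y, σ.SameCycle x y}

@[simp]
theorem mem_fullCycles {σ : Perm α} : σ ∈ fullCycles α ↔ ∀ x y, σ.SameCycle x y := by
  simp [fullCycles]

theorem mem_fullCycles_iff_cycleType (h : 2 ≤ Fintype.card α) {σ : Perm α} :
    σ ∈ fullCycles α ↔ σ.cycleType = {Fintype.card α} := by
  rw [mem_fullCycles]
  constructor
  · intro hσ
    have : Nontrivial α := Fintype.one_lt_card_iff_nontrivial.1 h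
    have hne : ∀ x, σ x ≠ x := by
      intro x hx
      obtain ⟨y, hy⟩ := exists_ne x
      exact hy (((hσ x y).eq_of_left hx).symm)
    obtain ⟨x⟩ : Nonempty α := inferInstance
    have hc : σ.IsCycle := ⟨x, hne x, fun y _ => hσ x y⟩
    rw [hc.cycleType]
    congr 1
    rw [← card_univ]
    congr 1
    ext y
    simp [hne]
  · intro hσ x y
    have hc : σ.IsCycle := card_cycleType_eq_one.1 (by rw [hσ]; simp)
    have hs : σ.support = univ := by
      rw [← card_eq_iff_eq_univ, ← sum_cycleType, hσ]
      simp
    have hne : ∀ x, σ x ≠ x := fun x => mem_support.1 (hs ▸ mem_univ x)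
    exact hc.sameCycle (hne x) (hne y)

theorem card_fullCycles (h : 2 ≤ Fintype.card α) :
    #(fullCycles α) = (Fintype.card α - 1).factorial := by
  have : fullCycles α = ({g | g.cycleType = {Fintype.card α}} : Finset (Perm α)) := by
    ext σ
    simp only [mem_fullCycles_iff_cycleType h, mem_filter, mem_univ, true_and]
  rw [this, card_of_cycleType_singleton h le_rfl]
  simp

/-- The number of ways to multiply `π` by `k` transpositions on the right so as to obtain a
transitive permutation. -/
def numCompletions (k : ℕ) (π : Perm α) : ℕ :=
  ∑ σ ∈ fullCycles α, numSwapFactorizations k (π⁻¹ * σ)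

theorem numCompletions_zero (π : Perm α) :
    numCompletions 0 π = if π ∈ fullCycles α then 1 else 0 := by
  simp only [numCompletions, numSwapFactorizations, inv_mul_eq_one]
  rw [sum_ite_eq]

theorem numCompletions_succ (k : ℕ) (π : Perm α) :
    numCompletions (k + 1) π = ∑ τ ∈ swaps α, numCompletions k (π * τ) := by
  simp only [numCompletions, numSwapFactorizations]
  rw [sum_comm]
  simp only [mul_inv_rev, mul_assoc]

theorem two_mul_numCompletions_succ (k : ℕ) (π : Perm α) :
    2 * (numCompletions (k + 1) π : ℚ) =
      ∑ p ∈ (univ : Finset α).offDiag, (numCompletions k (π * swap p.1 p.2) : ℚ) := by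
  rw [sum_offDiag_swap fun τ => (numCompletions k (π * τ) : ℚ), numCompletions_succ, Nat.cast_sum]

theorem orbits_eq_of_mem_fullCycles [Nonempty α] {π : Perm α} (h : π ∈ fullCycles α) :
    π.orbits = {univ} := by
  have : ∀ x, π.orbitOf x = univ := fun x => by
    ext y
    simpa using mem_fullCycles.1 h x y
  rw [orbits, image_congr fun x _ => this x]
  exact image_const univ_nonempty _

theorem mem_fullCycles_of_card_orbits {π : Perm α} (h : #π.orbits ≤ 1) : π ∈ fullCycles α :=
  mem_fullCycles.2 fun _ _ => orbitOf_eq_orbitOf.1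
    (card_le_one.1 h _ orbitOf_mem_orbits _ orbitOf_mem_orbits)

theorem numCompletions_eq_zero [Nonempty α] (k : ℕ) (π : Perm α) (h : k + 1 < #π.orbits) :
    numCompletions k π = 0 := by
  induction k generalizing π with
  | zero =>
    rw [numCompletions_zero, if_neg]
    intro hπ
    simp [orbits_eq_of_mem_fullCycles hπ] at h
  | succ k ih =>
    rw [numCompletions_succ]
    refine sum_eq_zero fun τ hτ => ih _ ?_
    obtain ⟨a, b, -, rfl⟩ := mem_swaps.1 hτ
    by_cases hab : π.SameCycle a b
    · have := card_orbits_le_card_orbits_mul_swap hab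
      omega
    · have := card_orbits_mul_swap hab
      omega

/-- The analogue for transpositions of the count of trees containing a given spanning forest. -/
theorem card_mul_numCompletions [Nonempty α] (k : ℕ) (π : Perm α) (h : #π.orbits = k + 1) :
    (Fintype.card α * numCompletions k π : ℚ) =
      k.factorial * (Fintype.card α : ℚ) ^ k * ∏ B ∈ π.orbits, (#B : ℚ) := by
  induction k generalizing π with
  | zero =>
    have hπ := mem_fullCycles_of_card_orbits h.le
    rw [numCompletions_zero, if_pos hπ, orbits_eq_of_mem_fullCycles hπ]
    simp
  | succ k ih =>
    have hterm : ∀ a b, (Fintype.card α : ℚ) *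
        (if a = b then 0 else (numCompletions k (π * swap a b) : ℚ)) =
        (k.factorial * (Fintype.card α : ℚ) ^ k * ∏ B ∈ π.orbits, (#B : ℚ)) *
          (if π.SameCycle a b then 0
            else (#(π.orbitOf a) : ℚ)⁻¹ + (#(π.orbitOf b) : ℚ)⁻¹) := by
      intro a b
      by_cases hab : π.SameCycle a b
      · have := card_orbits_le_card_orbits_mul_swap hab
        rw [numCompletions_eq_zero k _ (by omega), if_pos hab]
        simp
      · have := card_orbits_mul_swap hab
        have hne : a ≠ b := fun h => hab (h ▸ SameCycle.refl _ _)
        rw [if_neg hne, if_neg hab, ih _ (by omega), prod_card_orbits_mul_swap hab]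
        ring
    have hoff : (univ : Finset α).offDiag = ({p | p.1 ≠ p.2} : Finset (α × α)) := by
      ext p
      simp
    have hsum : ∑ p ∈ (univ : Finset α).offDiag, (numCompletions k (π * swap p.1 p.2) : ℚ) =
        ∑ a, ∑ b, if a = b then 0 else (numCompletions k (π * swap a b) : ℚ) := by
      rw [← Fintype.sum_prod_type' (f := fun a b =>
        if a = b then 0 else (numCompletions k (π * swap a b) : ℚ)), hoff, sum_filter]
      simp
    have htwo : 2 * (Fintype.card α * numCompletions (k + 1) π : ℚ) =
        (k.factorial * (Fintype.card α : ℚ) ^ k * ∏ B ∈ π.orbits, (#B : ℚ)) *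
          (2 * (Fintype.card α * (#π.orbits - 1))) := by
      rw [mul_left_comm, two_mul_numCompletions_succ, hsum, mul_sum,
        ← sum_not_sameCycle_inv_card, mul_sum]
      simp_rw [mul_sum, hterm]
    rw [h] at htwo
    rw [Nat.factorial_succ]
    push_cast at htwo ⊢
    linear_combination htwo / 2

theorem numCompletions_one (h : 2 ≤ Fintype.card α) :
    numCompletions (Fintype.card α - 1) (1 : Perm α) =
      (Fintype.card α - 1).factorial * Fintype.card α ^ (Fintype.card α - 2) := by
  have : Nonempty α := Fintype.card_pos_iff.1 (by omega)
  have horb : (1 : Perm α).orbits = univ.image fun x : α => ({x} : Finset α) := by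
    refine image_congr fun x _ => ?_
    ext y
    simp [eq_comm]
  have hcard : #(1 : Perm α).orbits = Fintype.card α := by
    rw [horb, card_image_of_injective _ singleton_injective, card_univ]
  have hprod : ∏ B ∈ (1 : Perm α).orbits, (#B : ℚ) = 1 := by
    refine prod_eq_one fun B hB => ?_
    rw [horb] at hB
    obtain ⟨x, -, rfl⟩ := mem_image.1 hB
    simp
  have key := card_mul_numCompletions (Fintype.card α - 1) (1 : Perm α) (by omega)
  rw [hprod, mul_one, show Fintype.card α - 1 = Fintype.card α - 2 + 1 by omega] at key
  rw [show Fintype.card α - 1 = Fintype.card α - 2 + 1 by omega]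
  have h0 : (Fintype.card α : ℚ) ≠ 0 := by exact_mod_cast (by omega : Fintype.card α ≠ 0)
  have key' : (Fintype.card α : ℚ) * numCompletions (Fintype.card α - 2 + 1) (1 : Perm α) =
      Fintype.card α * ((Fintype.card α - 2 + 1).factorial *
        Fintype.card α ^ (Fintype.card α - 2)) := by
    rw [key, pow_succ]
    ring
  exact_mod_cast mul_left_cancel₀ h0 key'

theorem numSwapFactorizations_of_mem_fullCycles (h : 2 ≤ Fintype.card α) {σ : Perm α}
    (hσ : σ ∈ fullCycles α) :
    numSwapFactorizations (Fintype.card α - 1) σ = Fintype.card α ^ (Fintype.card α - 2) := by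
  have hconst : ∀ ρ ∈ fullCycles α, numSwapFactorizations (Fintype.card α - 1) (1⁻¹ * ρ) =
      numSwapFactorizations (Fintype.card α - 1) σ := by
    intro ρ hρ
    obtain ⟨g, rfl⟩ := isConj_iff.1 (isConj_iff_cycleType_eq.2
      (((mem_fullCycles_iff_cycleType h).1 hσ).trans
        ((mem_fullCycles_iff_cycleType h).1 hρ).symm))
    rw [inv_one, one_mul, numSwapFactorizations_conj]
  have key := numCompletions_one h
  rw [numCompletions, sum_congr rfl hconst, sum_const, card_fullCycles h, smul_eq_mul] at key
  exact Nat.eq_of_mul_eq_mul_left (Nat.factorial_pos _) key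

end FullCycles

end Equiv.Perm

/-- Dénes' theorem: a cycle of length `ℓ` on an `ℓ`-element set has exactly
`ℓ^(ℓ-2)` minimal factorizations into `ℓ - 1` transpositions. -/
theorem stmt13 {α : Type*} [Fintype α] [DecidableEq α] (ℓ : ℕ) (hℓ : 2 ≤ ℓ)
    (hcard : Fintype.card α = ℓ) (σ : Equiv.Perm α)
    (hcyc : ∀ x y : α, σ.SameCycle x y) :
    Nat.card {L : List (Equiv.Perm α) //
        L.length = ℓ - 1 ∧ (∀ τ ∈ L, τ.IsSwap) ∧ L.prod = σ}
      = ℓ ^ (ℓ - 2) := by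
  subst hcard
  rw [Equiv.Perm.natCard_swapFactorizations]
  exact Equiv.Perm.numSwapFactorizations_of_mem_fullCycles hℓ (Equiv.Perm.mem_fullCycles.2 hcyc)
end

section
/- Let B be a coassociative counital coalgebra over ℂ with comultiplication Δ and counit ε. For linear functionals ψ, φ : B → ℂ define their convolution ψ ⋆ φ : B → ℂ as the composition of Δ with ψ ⊗ φ (so (ψ ⋆ φ)(b) = ∑ ψ(b₍₁₎) φ(b₍₂₎) in Sweedler notation), and convolution powers by ψ^{⋆0} = ε and ψ^{⋆(n+1)} = ψ^{⋆n} ⋆ ψ. Then for every linear functional ψ : B → ℂ and every b ∈ B, the series ∑_{n≥0} ψ^{⋆n}(b) / n! converges absolutely in ℂ. -/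
open TensorProduct

/-- Convolution of linear functionals on a coalgebra: `ψ ⋆ φ = (ψ ⊗ φ) ∘ Δ`. -/
noncomputable def conv {B : Type*} [AddCommGroup B] [Module ℂ B] [Coalgebra ℂ B]
    (ψ φ : B →ₗ[ℂ] ℂ) : B →ₗ[ℂ] ℂ :=
  LinearMap.mul' ℂ ℂ ∘ₗ TensorProduct.map ψ φ ∘ₗ Coalgebra.comul

/-- Convolution powers: `ψ^{⋆0} = ε` and `ψ^{⋆(n+1)} = ψ^{⋆n} ⋆ ψ`. -/
noncomputable def convPow {B : Type*} [AddCommGroup B] [Module ℂ B] [Coalgebra ℂ B]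
    (ψ : B →ₗ[ℂ] ℂ) : ℕ → (B →ₗ[ℂ] ℂ)
  | 0 => Coalgebra.counit
  | n + 1 => conv (convPow ψ n) ψ

/-- The right convolution action of a functional on a coalgebra: `b ↦ ∑ φ(b₍₂₎) b₍₁₎`. -/
noncomputable def convAct {B : Type*} [AddCommGroup B] [Module ℂ B] [Coalgebra ℂ B]
    (φ : B →ₗ[ℂ] ℂ) : Module.End ℂ B :=
  (TensorProduct.rid ℂ B).toLinearMap ∘ₗ LinearMap.lTensor B φ ∘ₗ Coalgebra.comul

section ConvAct

variable {B : Type*} [AddCommGroup B] [Module ℂ B] [Coalgebra ℂ B]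

theorem convAct_counit : convAct (Coalgebra.counit : B →ₗ[ℂ] ℂ) = 1 := by
  ext b
  simp [convAct]

theorem convAct_conv (φ ψ : B →ₗ[ℂ] ℂ) : convAct (conv φ ψ) = convAct φ * convAct ψ := by
  let F : B ⊗[ℂ] (B ⊗[ℂ] B) →ₗ[ℂ] B := (TensorProduct.rid ℂ B).toLinearMap ∘ₗ
    LinearMap.lTensor B (LinearMap.mul' ℂ ℂ ∘ₗ TensorProduct.map φ ψ)
  have hF : F ∘ₗ (TensorProduct.assoc ℂ B B B).toLinearMap ∘ₗ
      LinearMap.rTensor B Coalgebra.comul = convAct φ ∘ₗ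
        (TensorProduct.rid ℂ B).toLinearMap ∘ₗ LinearMap.lTensor B ψ := by
    ext x y
    simp only [convAct, F, TensorProduct.AlgebraTensorModule.curry_apply, TensorProduct.curry_apply,
      LinearMap.coe_restrictScalars, LinearMap.comp_apply, LinearMap.rTensor_tmul,
      LinearMap.lTensor_tmul, LinearEquiv.coe_coe, TensorProduct.rid_tmul, map_smul]
    induction Coalgebra.comul (R := ℂ) x with
    | zero => simp
    | tmul a c => simp [smul_smul, mul_comm]
    | add s t hs ht => simp only [TensorProduct.add_tmul, map_add, hs, ht, smul_add]
  calc convAct (conv φ ψ) = F ∘ₗ LinearMap.lTensor B Coalgebra.comul ∘ₗ Coalgebra.comul := by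
        simp only [convAct, conv, F, LinearMap.lTensor_comp, LinearMap.comp_assoc]
    _ = (F ∘ₗ (TensorProduct.assoc ℂ B B B).toLinearMap ∘ₗ
          LinearMap.rTensor B Coalgebra.comul) ∘ₗ Coalgebra.comul := by
        rw [← Coalgebra.coassoc]; rfl
    _ = convAct φ * convAct ψ := by rw [hF]; rfl

theorem convAct_convPow (ψ : B →ₗ[ℂ] ℂ) (n : ℕ) : convAct (convPow ψ n) = convAct ψ ^ n := by
  induction n with
  | zero => exact convAct_counit
  | succ n ih => rw [convPow, convAct_conv, ih, pow_succ]

theorem convAct_apply {ι : Type*} {b : B} (r : Coalgebra.Repr ℂ b ι) (φ : B →ₗ[ℂ] ℂ) :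
    convAct φ b = ∑ i ∈ r.index, φ (r.right i) • r.left i := by
  simp [convAct, ← r.eq]

theorem counit_convAct (φ : B →ₗ[ℂ] ℂ) (b : B) : Coalgebra.counit (R := ℂ) (convAct φ b) = φ b := by
  let r := Coalgebra.Repr.arbitrary ℂ b
  rw [convAct_apply r]
  conv_rhs => rw [← Coalgebra.sum_counit_smul r]
  simp [mul_comm]

theorem finiteDimensional_span_convAct_pow (ψ : B →ₗ[ℂ] ℂ) (b : B) :
    FiniteDimensional ℂ (Submodule.span ℂ (Set.range fun n : ℕ => (convAct ψ ^ n) b)) := by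
  let r := Coalgebra.Repr.arbitrary ℂ b
  have := FiniteDimensional.span_of_finite ℂ (r.index.finite_toSet.image r.left)
  refine Submodule.finiteDimensional_of_le (Submodule.span_le.2 ?_)
    (S₂ := Submodule.span ℂ (r.left '' r.index))
  rintro _ ⟨n, rfl⟩
  simp only [← convAct_convPow, convAct_apply r]
  exact Submodule.sum_mem _ fun i hi =>
    Submodule.smul_mem _ _ (Submodule.subset_span ⟨i, hi, rfl⟩)

end ConvAct

theorem exists_norm_apply_pow_le {V : Type*} [AddCommGroup V] [Module ℂ V]
    [FiniteDimensional ℂ V] (T : Module.End ℂ V) (f : V →ₗ[ℂ] ℂ) (v : V) :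
    ∃ C r : ℝ, ∀ n : ℕ, ‖f ((T ^ n) v)‖ ≤ C * r ^ n := by
  let e := (Module.finBasis ℂ V).equivFun
  let S := LinearMap.toContinuousLinearMap (e.conj T)
  let g := LinearMap.toContinuousLinearMap (f ∘ₗ e.symm.toLinearMap)
  have hS (n : ℕ) : (T ^ n) v = e.symm ((S ^ n) (e v)) := by
    induction n with
    | zero => simp
    | succ n ih =>
      rw [pow_succ', pow_succ', Module.End.mul_apply, ih]
      simp [S, LinearEquiv.conj_apply]
  refine ⟨‖g‖ * ‖e v‖, ‖S‖, fun n => ?_⟩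
  calc ‖f ((T ^ n) v)‖ = ‖g ((S ^ n) (e v))‖ := by rw [hS]; rfl
    _ ≤ ‖g‖ * (‖S ^ n‖ * ‖e v‖) := g.le_opNorm_of_le ((S ^ n).le_opNorm _)
    _ ≤ ‖g‖ * (‖S‖ ^ n * ‖e v‖) := by
        gcongr
        cases n with
        | zero => exact ContinuousLinearMap.norm_id_le
        | succ n => exact norm_pow_le' S n.succ_pos
    _ = ‖g‖ * ‖e v‖ * ‖S‖ ^ n := by ring

/-- Schoenberg correspondence, part 1: the convolution exponential series
`∑ ψ^{⋆n}(b) / n!` converges absolutely for every linear functional `ψ` on a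
coassociative counital coalgebra over `ℂ` and every `b`. -/
theorem stmt15 {B : Type*} [AddCommGroup B] [Module ℂ B] [Coalgebra ℂ B]
    (ψ : B →ₗ[ℂ] ℂ) (b : B) :
    Summable (fun n : ℕ => ‖convPow ψ n b / (n.factorial : ℂ)‖) := by
  let T := convAct ψ
  let W := Submodule.span ℂ (Set.range fun n : ℕ => (T ^ n) b)
  have : FiniteDimensional ℂ W := finiteDimensional_span_convAct_pow ψ b
  have hb : b ∈ W := Submodule.subset_span ⟨0, by simp⟩
  have hT : ∀ w ∈ W, T w ∈ W := fun w hw => by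
    refine (Submodule.span_le (p := W.comap T)).2 ?_ hw
    rintro _ ⟨n, rfl⟩
    exact Submodule.subset_span ⟨n + 1, by simp [pow_succ']⟩
  obtain ⟨C, r, hC⟩ := exists_norm_apply_pow_le (T.restrict hT)
    (Coalgebra.counit ∘ₗ W.subtype) ⟨b, hb⟩
  refine Summable.of_nonneg_of_le (fun _ => norm_nonneg _) (fun n => ?_)
    ((Real.summable_pow_div_factorial r).mul_left C)
  rw [norm_div, Complex.norm_natCast, ← mul_div_assoc, ← counit_convAct, convAct_convPow]
  gcongr
  have h := hC n
  rw [Module.End.pow_restrict] at h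
  exact h
end

section
/- Let B be a coassociative counital coalgebra over ℂ with comultiplication Δ and counit ε, and let convolution of linear functionals be defined by ψ ⋆ φ = (ψ ⊗ φ) ∘ Δ, with ψ^{⋆0} = ε and ψ^{⋆(n+1)} = ψ^{⋆n} ⋆ ψ. Let (φ_t)_{t ≥ 0} be a family of linear functionals on B such that φ_0 = ε, φ_{s+t} = φ_s ⋆ φ_t for all s, t ≥ 0, and t ↦ φ_t(b) is continuous on [0, ∞) for every b ∈ B. Then for every b ∈ B the limit L(b) = lim_{t → 0⁺} (φ_t(b) − ε(b)) / t exists, L is a linear functional on B, and φ_t(b) = ∑_{n ≥ 0} tⁿ L^{⋆n}(b) / n! for every t ≥ 0 and every b ∈ B. -/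
open TensorProduct

open Set in
/-- A norm-continuous one-parameter semigroup in a Banach algebra is the exponential of its
derivative at zero. -/
theorem exists_eq_exp_of_continuousOn_semigroup {E : Type*} [NormedRing E] [NormedAlgebra ℝ E]
    [CompleteSpace E] (S : ℝ → E) (h0 : S 0 = 1)
    (hsemi : ∀ s t : ℝ, 0 ≤ s → 0 ≤ t → S (s + t) = S s * S t)
    (hcont : ContinuousOn S (Ici 0)) :
    ∃ A : E, HasDerivWithinAt S A (Ici 0) 0 ∧ ∀ t, 0 ≤ t → S t = NormedSpace.exp (t • A) := by
  have hproj : Continuous fun t : ℝ => S (max t 0) :=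
    hcont.comp_continuous (by fun_prop) fun t => le_max_right t 0
  set R : ℝ → E := fun t => S (max t 0) with hR
  have hRS : ∀ t, 0 ≤ t → R t = S t := fun t ht => by simp [hR, ht]
  set F : ℝ → E := fun t => ∫ u in (0 : ℝ)..t, R u with hF
  have hF' : ∀ t, HasDerivAt F (R t) t := fun t =>
    intervalIntegral.integral_hasDerivAt_right (hproj.intervalIntegrable _ _)
      (hproj.stronglyMeasurableAtFilter _ _) hproj.continuousAt
  obtain ⟨h, hpos, hunit⟩ : ∃ h : ℝ, 0 < h ∧ IsUnit (F h) := by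
    have hlim : Filter.Tendsto (fun t : ℝ => t⁻¹ • F t) (nhdsWithin 0 (Ioi 0)) (nhds 1) := by
      have := (hF' 0).tendsto_slope_zero_right
      simpa [hF, hRS 0 le_rfl, h0] using this
    obtain ⟨h, hu, hpos⟩ := ((hlim.eventually (Units.isOpen.mem_nhds isUnit_one)).and
      self_mem_nhdsWithin).exists
    refine ⟨h, hpos, ?_⟩
    have hne : h ≠ 0 := ne_of_gt hpos
    have hu' : IsUnit (h⁻¹ • F h) := hu
    simpa [smul_smul, hne] using hu'.smul (Units.mk0 h hne)
  obtain ⟨U, hU⟩ := hunit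
  have hshift : ∀ t, 0 ≤ t → S t * F h = F (t + h) - F t := by
    intro t ht
    have e1 : F (t + h) - F t = ∫ u in t..(t + h), R u :=
      intervalIntegral.integral_interval_sub_left (hproj.intervalIntegrable _ _)
        (hproj.intervalIntegrable _ _)
    have e2 : ∫ u in (0 : ℝ)..h, R (t + u) = ∫ u in t..(t + h), R u := by
      simp
    have e3 : S t * F h = ∫ u in (0 : ℝ)..h, S t * R u :=
      ((ContinuousLinearMap.mul ℝ E (S t)).intervalIntegral_comp_comm
        (hproj.intervalIntegrable _ _)).symm
    rw [e1, ← e2, e3]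
    refine intervalIntegral.integral_congr fun u hu => ?_
    rw [uIcc_of_le hpos.le] at hu
    simp only [hRS u hu.1, hRS (t + u) (add_nonneg ht hu.1), hsemi t u ht hu.1]
  set G : ℝ → E := fun t => (F (t + h) - F t) * ↑U⁻¹ with hG
  have hGS : ∀ t, 0 ≤ t → S t = G t := fun t ht => by
    simp only [hG, ← hshift t ht, ← hU, Units.mul_inv_cancel_right]
  set A : E := (S h - 1) * ↑U⁻¹ with hA
  have hG' : ∀ t, 0 ≤ t → HasDerivAt G (S t * A) t := by
    intro t ht
    have := (((hF' (t + h)).comp_add_const t h).sub (hF' t)).mul_const (↑U⁻¹ : E)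
    rwa [hRS t ht, hRS (t + h) (by positivity), hsemi t h ht hpos.le, ← mul_sub_one, mul_assoc,
      ← hA] at this
  have hS' : ∀ t, 0 ≤ t → HasDerivWithinAt S (S t * A) (Ici t) t := fun t ht =>
    (hG' t ht).hasDerivWithinAt.congr (fun x hx => hGS x (ht.trans hx)) (hGS t ht)
  refine ⟨A, by simpa [h0] using hS' 0 le_rfl, fun t ht => ?_⟩
  have hexp : ∀ s : ℝ, HasDerivAt (fun u : ℝ => NormedSpace.exp (u • (-A)))
      (-A * NormedSpace.exp (s • (-A))) s := fun s => hasDerivAt_exp_smul_const' (-A) s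
  have hconst := constant_of_has_deriv_right_zero (a := 0) (b := t)
    (f := fun s => S s * NormedSpace.exp (s • (-A)))
    ((hcont.mono Icc_subset_Ici_self).mul fun s _ => (hexp s).continuousAt.continuousWithinAt)
    (fun s hs => by
      have hzero : S s * A * NormedSpace.exp (s • (-A)) +
          S s * (-A * NormedSpace.exp (s • (-A))) = 0 := by
        rw [neg_mul, mul_neg, mul_assoc, add_neg_cancel]
      exact hzero ▸ (hS' s hs.1).mul (hexp s).hasDerivWithinAt)
    t ⟨ht, le_rfl⟩
  simp only [h0, zero_smul, NormedSpace.exp_zero, mul_one] at hconst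
  have hinv : NormedSpace.exp (t • (-A)) * NormedSpace.exp (t • A) = 1 := by
    let : NormedAlgebra ℚ E := NormedAlgebra.restrictScalars ℚ ℝ E
    rw [← NormedSpace.exp_add_of_commute (((Commute.refl A).neg_left.smul_left t).smul_right t)]
    simp
  calc S t = S t * NormedSpace.exp (t • (-A)) * NormedSpace.exp (t • A) := by
        rw [mul_assoc, hinv, mul_one]
    _ = NormedSpace.exp (t • A) := by rw [hconst, one_mul]

/-- The action of functionals on a coalgebra: `ψ` acts by `(id ⊗ ψ) ∘ Δ`. -/
noncomputable def functionalAct {B : Type*} [AddCommGroup B] [Module ℂ B] [Coalgebra ℂ B] :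
    (B →ₗ[ℂ] ℂ) →ₗ[ℂ] B →ₗ[ℂ] B where
  toFun ψ := (TensorProduct.rid ℂ B).toLinearMap ∘ₗ LinearMap.lTensor B ψ ∘ₗ Coalgebra.comul
  map_add' ψ φ := by ext; simp [LinearMap.lTensor_add]
  map_smul' r ψ := by ext; simp [LinearMap.lTensor_smul]

section FunctionalAct

variable {B : Type*} [AddCommGroup B] [Module ℂ B] [Coalgebra ℂ B]

theorem functionalAct_apply (ψ : B →ₗ[ℂ] ℂ) (b : B) :
    functionalAct ψ b = TensorProduct.rid ℂ B (LinearMap.lTensor B ψ (Coalgebra.comul b)) := rfl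

theorem functionalAct_counit (b : B) : functionalAct Coalgebra.counit b = b := by
  simp [functionalAct_apply]

theorem apply_functionalAct (f ψ : B →ₗ[ℂ] ℂ) (b : B) :
    f (functionalAct ψ b) =
      ψ (TensorProduct.lid ℂ B (LinearMap.rTensor B f (Coalgebra.comul b))) := by
  rw [functionalAct_apply]
  induction (Coalgebra.comul b : B ⊗[ℂ] B) with
  | zero => simp
  | tmul x y => simp [mul_comm]
  | add x y hx hy => simp only [map_add, hx, hy]

theorem counit_functionalAct (ψ : B →ₗ[ℂ] ℂ) (b : B) :
    Coalgebra.counit (R := ℂ) (functionalAct ψ b) = ψ b := by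
  simp [apply_functionalAct]

theorem functionalAct_conv (ψ φ : B →ₗ[ℂ] ℂ) (b : B) :
    functionalAct (conv ψ φ) b = functionalAct ψ (functionalAct φ b) := by
  have hl : functionalAct (conv ψ φ) b = TensorProduct.rid ℂ B
      (LinearMap.lTensor B (LinearMap.mul' ℂ ℂ ∘ₗ TensorProduct.map ψ φ)
        (TensorProduct.assoc ℂ B B B
          (LinearMap.rTensor B Coalgebra.comul (Coalgebra.comul b)))) := by
    rw [Coalgebra.coassoc_apply, functionalAct_apply, conv, ← LinearMap.comp_assoc,
      LinearMap.lTensor_comp_apply]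
  rw [hl, functionalAct_apply φ]
  induction (Coalgebra.comul b : B ⊗[ℂ] B) with
  | zero => simp
  | add x y hx hy => simp only [map_add, hx, hy]
  | tmul x z =>
    simp only [LinearMap.rTensor_tmul, LinearMap.lTensor_tmul, TensorProduct.rid_tmul, map_smul,
      functionalAct_apply ψ]
    induction (Coalgebra.comul x : B ⊗[ℂ] B) with
    | zero => simp
    | add x y hx hy => simp only [map_add, TensorProduct.add_tmul, smul_add, hx, hy]
    | tmul x y => simp [smul_smul, mul_comm]

theorem finiteDimensional_range_functionalAct_flip (b : B) :
    FiniteDimensional ℂ (LinearMap.range (functionalAct.flip b : (B →ₗ[ℂ] ℂ) →ₗ[ℂ] B)) := by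
  classical
  let r := Coalgebra.Repr.arbitrary ℂ b
  refine Submodule.finiteDimensional_of_le
    (S₂ := Submodule.span ℂ (r.index.image r.left : Set B)) ?_
  rintro _ ⟨ψ, rfl⟩
  rw [LinearMap.flip_apply, functionalAct_apply, ← r.eq]
  simp only [map_sum, LinearMap.lTensor_tmul, TensorProduct.rid_tmul]
  exact Submodule.sum_mem _ fun i hi => Submodule.smul_mem _ _
    (Submodule.subset_span (Finset.mem_coe.2 (Finset.mem_image_of_mem _ hi)))

/-- Every element of a coalgebra is a linear combination of the coefficients of a
finite-dimensional matrix corepresentation. -/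
theorem exists_matrix_coefficients (b : B) :
    ∃ (n : ℕ) (c : Matrix (Fin n) (Fin n) B) (w : Matrix (Fin n) (Fin n) ℂ),
      (∀ i j, Coalgebra.counit (c i j) = (1 : Matrix (Fin n) (Fin n) ℂ) i j) ∧
      (∀ (ψ φ : B →ₗ[ℂ] ℂ) (i j), conv ψ φ (c i j) = ∑ k, ψ (c i k) * φ (c k j)) ∧
      ∀ ψ : B →ₗ[ℂ] ℂ, ψ b = ∑ i, ∑ j, w i j * ψ (c i j) := by
  have := finiteDimensional_range_functionalAct_flip b
  set V := LinearMap.range (functionalAct.flip b : (B →ₗ[ℂ] ℂ) →ₗ[ℂ] B) with hV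
  have hbV : b ∈ V := ⟨Coalgebra.counit, functionalAct_counit b⟩
  have hVinv : ∀ (ψ : B →ₗ[ℂ] ℂ), ∀ x ∈ V, functionalAct ψ x ∈ V := by
    rintro ψ _ ⟨φ, rfl⟩
    exact ⟨conv ψ φ, functionalAct_conv ψ φ b⟩
  let e := Module.finBasis ℂ V
  choose f hf using fun i => LinearMap.exists_extend (e.coord i)
  have hfe : ∀ i (x : V), f i x = e.repr x i := fun i x => LinearMap.congr_fun (hf i) x
  have hexpand : ∀ x ∈ V, x = ∑ i, f i x • (e i : B) := by
    intro x hx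
    have := congrArg Subtype.val (e.sum_repr ⟨x, hx⟩)
    simpa [← hfe] using this.symm
  obtain ⟨c, hc⟩ : ∃ c : Matrix (Fin _) (Fin _) B,
      ∀ (ψ : B →ₗ[ℂ] ℂ) i j, ψ (c i j) = f i (functionalAct ψ (e j)) :=
    ⟨fun i j => TensorProduct.lid ℂ B (LinearMap.rTensor B (f i) (Coalgebra.comul (e j : B))),
      fun ψ i j => (apply_functionalAct (f i) ψ (e j)).symm⟩
  have hact : ∀ (ψ : B →ₗ[ℂ] ℂ) j, functionalAct ψ (e j) = ∑ k, ψ (c k j) • (e k : B) := by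
    intro ψ j
    simp only [hc]
    exact hexpand _ (hVinv ψ _ (e j).2)
  refine ⟨_, c, fun i j => f j b * Coalgebra.counit (e i : B), fun i j => ?_,
    fun ψ φ i j => ?_, fun ψ => ?_⟩
  · rw [hc, functionalAct_counit, hfe, e.repr_self, Matrix.one_apply, Finsupp.single_apply]
    simp only [eq_comm]
  · rw [hc, functionalAct_conv, hact φ]
    simp only [map_sum, map_smul, ← hc, smul_eq_mul]
    exact Finset.sum_congr rfl fun k _ => mul_comm _ _
  · conv_lhs => rw [← counit_functionalAct, hexpand b hbV]
    simp only [map_sum, map_smul, hact, smul_eq_mul, Finset.mul_sum]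
    rw [Finset.sum_comm]
    exact Finset.sum_congr rfl fun i _ => Finset.sum_congr rfl fun j _ => by ring

end FunctionalAct

theorem convPow_matrix_coefficients {B : Type*} [AddCommGroup B] [Module ℂ B] [Coalgebra ℂ B]
    {n : ℕ} {c : Matrix (Fin n) (Fin n) B}
    (hone : ∀ i j, Coalgebra.counit (c i j) = (1 : Matrix (Fin n) (Fin n) ℂ) i j)
    (hmul : ∀ (ψ φ : B →ₗ[ℂ] ℂ) (i j), conv ψ φ (c i j) = ∑ k, ψ (c i k) * φ (c k j))
    (L : B →ₗ[ℂ] ℂ) (m : ℕ) : c.map (convPow L m) = c.map L ^ m := by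
  induction m with
  | zero =>
    ext i j
    exact hone i j
  | succ m ih =>
    ext i j
    rw [pow_succ, ← ih]
    exact hmul _ _ i j

open scoped Matrix.Norms.Operator in
/-- The matrix coefficients of a continuous convolution semigroup form a matrix exponential. -/
theorem exists_exp_matrix_coefficients {B : Type*} [AddCommGroup B] [Module ℂ B] [Coalgebra ℂ B]
    {n : ℕ} {c : Matrix (Fin n) (Fin n) B}
    (hone : ∀ i j, Coalgebra.counit (c i j) = (1 : Matrix (Fin n) (Fin n) ℂ) i j)
    (hmul : ∀ (ψ φ : B →ₗ[ℂ] ℂ) (i j), conv ψ φ (c i j) = ∑ k, ψ (c i k) * φ (c k j))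
    (φ : ℝ → (B →ₗ[ℂ] ℂ)) (h0 : φ 0 = Coalgebra.counit)
    (hsemi : ∀ s t : ℝ, 0 ≤ s → 0 ≤ t → φ (s + t) = conv (φ s) (φ t))
    (hcont : ∀ b : B, ContinuousOn (fun t : ℝ => φ t b) (Set.Ici (0 : ℝ))) :
    ∃ A : Matrix (Fin n) (Fin n) ℂ,
      (∀ i j, HasDerivWithinAt (fun t => φ t (c i j)) (A i j) (Set.Ici 0) 0) ∧
      ∀ t : ℝ, 0 ≤ t → ∀ i j,
        HasSum (fun m : ℕ => ((t : ℂ) ^ m / (m.factorial : ℂ)) * (A ^ m) i j) (φ t (c i j)) := by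
  obtain ⟨A, hA, hexp⟩ := exists_eq_exp_of_continuousOn_semigroup (fun t => c.map (φ t))
    (by
      ext i j
      simp only [Matrix.map_apply, h0, hone])
    (fun s t hs ht => by
      ext i j
      simp only [Matrix.map_apply, Matrix.mul_apply, hsemi s t hs ht, hmul])
    (continuousOn_pi.2 fun i => continuousOn_pi.2 fun j => hcont (c i j))
  have hentry (i j : Fin n) : Continuous fun M : Matrix (Fin n) (Fin n) ℂ => M i j :=
    continuous_id.matrix_elem i j
  let entry (i j : Fin n) : Matrix (Fin n) (Fin n) ℂ →L[ℝ] ℂ :=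
    ⟨Matrix.entryLinearMap ℝ ℂ i j, hentry i j⟩
  refine ⟨A, fun i j => (entry i j).hasFDerivAt.comp_hasDerivWithinAt 0 hA, fun t ht i j => ?_⟩
  have := (NormedSpace.exp_series_hasSum_exp' (𝕂 := ℝ) (t • A)).mapL (entry i j)
  rw [← hexp t ht] at this
  change HasSum _ (φ t (c i j)) at this
  convert this using 2 with m
  change _ = ((m.factorial : ℝ)⁻¹ • (t • A) ^ m) i j
  simp only [smul_pow, Matrix.smul_apply, Complex.real_smul]
  push_cast
  ring

theorem tendsto_div_of_hasDerivWithinAt {B : Type*} [AddCommGroup B] [Module ℂ B]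
    [Coalgebra ℂ B] (φ : ℝ → (B →ₗ[ℂ] ℂ)) (h0 : φ 0 = Coalgebra.counit) {b : B} {l : ℂ}
    (h : HasDerivWithinAt (fun t => φ t b) l (Set.Ici 0) 0) :
    Filter.Tendsto (fun t : ℝ => (φ t b - Coalgebra.counit b) / (t : ℂ))
      (nhdsWithin 0 (Set.Ioi 0)) (nhds l) := by
  refine ((hasDerivWithinAt_iff_tendsto_slope' Set.self_notMem_Ioi).1
    (h.mono Set.Ioi_subset_Ici_self)).congr fun t => ?_
  simp [slope_def_module, h0, div_eq_inv_mul]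

/-- Schoenberg correspondence, part 2 (tensor convolution): a pointwise
continuous convolution semigroup `(φ_t)_{t ≥ 0}` of functionals with `φ_0 = ε`
has a generator `L(b) = lim_{t→0⁺} (φ_t(b) - ε(b))/t`, which is a linear
functional, and `φ_t(b) = ∑_{n≥0} tⁿ L^{⋆n}(b)/n!` for all `t ≥ 0`. -/
theorem stmt16 {B : Type*} [AddCommGroup B] [Module ℂ B] [Coalgebra ℂ B]
    (φ : ℝ → (B →ₗ[ℂ] ℂ))
    (h0 : φ 0 = Coalgebra.counit)
    (hsemi : ∀ s t : ℝ, 0 ≤ s → 0 ≤ t → φ (s + t) = conv (φ s) (φ t))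
    (hcont : ∀ b : B, ContinuousOn (fun t : ℝ => φ t b) (Set.Ici (0 : ℝ))) :
    ∃ L : B →ₗ[ℂ] ℂ,
      (∀ b : B,
        Filter.Tendsto (fun t : ℝ => (φ t b - Coalgebra.counit b) / (t : ℂ))
          (nhdsWithin 0 (Set.Ioi 0)) (nhds (L b))) ∧
      (∀ t : ℝ, 0 ≤ t → ∀ b : B,
        HasSum (fun n : ℕ => ((t : ℂ) ^ n / (n.factorial : ℂ)) * convPow L n b)
          (φ t b)) := by
  have key : ∀ b : B, ∃ l : ℂ,
      Filter.Tendsto (fun t : ℝ => (φ t b - Coalgebra.counit b) / (t : ℂ))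
        (nhdsWithin 0 (Set.Ioi 0)) (nhds l) := by
    intro b
    obtain ⟨n, c, w, hone, hmul, hb⟩ := exists_matrix_coefficients b
    obtain ⟨A, hA, -⟩ := exists_exp_matrix_coefficients hone hmul φ h0 hsemi hcont
    have hderiv : HasDerivWithinAt (fun t => φ t b) (∑ i, ∑ j, w i j * A i j) (Set.Ici 0) 0 := by
      simp only [hb]
      exact HasDerivWithinAt.fun_sum fun i _ => HasDerivWithinAt.fun_sum fun j _ =>
        (hA i j).const_mul (w i j)
    exact ⟨_, tendsto_div_of_hasDerivWithinAt φ h0 hderiv⟩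
  choose l hl using key
  let L : B →ₗ[ℂ] ℂ :=
    { toFun := l
      map_add' := fun x y => tendsto_nhds_unique (hl (x + y))
        (((hl x).add (hl y)).congr fun t => by simp only [map_add]; ring)
      map_smul' := fun r x => tendsto_nhds_unique (hl (r • x))
        (((hl x).const_mul r).congr fun t => by simp only [map_smul, smul_eq_mul]; ring) }
  refine ⟨L, hl, fun t ht b => ?_⟩
  obtain ⟨n, c, w, hone, hmul, hb⟩ := exists_matrix_coefficients b
  obtain ⟨A, hA, hsum⟩ := exists_exp_matrix_coefficients hone hmul φ h0 hsemi hcont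
  have hAL : A = c.map L := by
    ext i j
    exact tendsto_nhds_unique (tendsto_div_of_hasDerivWithinAt φ h0 (hA i j)) (hl (c i j))
  have hpow : ∀ m i j, (A ^ m) i j = convPow L m (c i j) := fun m i j => by
    rw [hAL, ← convPow_matrix_coefficients hone hmul, Matrix.map_apply]
  rw [hb (φ t)]
  have hterm : ∀ m : ℕ, (t : ℂ) ^ m / (m.factorial : ℂ) * convPow L m b =
      ∑ i, ∑ j, w i j * ((t : ℂ) ^ m / (m.factorial : ℂ) * (A ^ m) i j) := fun m => by
    simp only [hb (convPow L m), hpow, Finset.mul_sum]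
    exact Finset.sum_congr rfl fun i _ => Finset.sum_congr rfl fun j _ => by ring
  simp only [hterm]
  exact hasSum_sum fun i _ => hasSum_sum fun j _ => (hsum t ht i j).mul_left (w i j)
end

section
/- Fix integers n, p ≥ 1. For a permutation σ of Fin p let nc(σ) be its number of orbits, and let T₊(σ) be the set of transpositions τ of Fin p with nc(σ ∘ τ) = nc(σ) + 1. For functions i, j : Fin p → Fin n write δ_{i,j} = 1 ∈ ℚ if i = j and 0 otherwise. Define rational numbers P^{σ,k}_{i,j} by the recursion P^{σ,0}_{i,j} = δ_{i,j} and P^{σ,k}_{i,j} = (1/n) · ∑_{τ ∈ T₊(σ)} P^{σ∘τ, k−1}_{i∘τ, j} for k ≥ 1. Then for all k ≥ 1: P^{σ,k}_{i,j} = n^{−k} · ∑ δ_{i ∘ τ_1 ∘ ⋯ ∘ τ_k, j}, the sum running over all k-tuples (τ_1, …, τ_k) of transpositions of Fin p such that nc(σ ∘ τ_1 ∘ ⋯ ∘ τ_k) = nc(σ) + k. Moreover, for k = d(σ) := p − nc(σ) one has P^{σ, d(σ)}_{i,j} = n^{−d(σ)} · M(σ) · δ_{i ∘ σ⁻¹,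 j}, where M(σ) is the number of d(σ)-tuples of transpositions whose product is σ. -/
open scoped Classical

/-- The number of orbits of a permutation `σ` (fixed points counting as orbits
of size one). -/
noncomputable def nc {α : Type*} (σ : Equiv.Perm α) : ℕ :=
  Nat.card (MulAction.orbitRel.Quotient (Subgroup.zpowers σ) α)

lemma orbitRel_zpowers_iff_sameCycle {α : Type*} (σ : Equiv.Perm α) (x y : α) :
    MulAction.orbitRel (Subgroup.zpowers σ) α x y ↔ σ.SameCycle y x := by
  rw [MulAction.orbitRel_apply, MulAction.mem_orbit_iff]
  constructor
  · rintro ⟨⟨_, k, rfl⟩, hk⟩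
    exact ⟨k, hk⟩
  · rintro ⟨k, hk⟩
    exact ⟨⟨σ ^ k, k, rfl⟩, hk⟩

/-- A cycle of `σ * swap a b` meeting neither `a` nor `b` is a cycle of `σ`. -/
lemma sameCycle_mul_swap_of_not_sameCycle {α : Type*} [Finite α] [DecidableEq α]
    {σ : Equiv.Perm α} {a b x y : α}
    (ha : ¬ (σ * Equiv.swap a b).SameCycle x a) (hb : ¬ (σ * Equiv.swap a b).SameCycle x b)
    (h : σ.SameCycle x y) : (σ * Equiv.swap a b).SameCycle x y := by
  obtain ⟨k, rfl⟩ := h.exists_nat_pow_eq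
  have key : ∀ m : ℕ, ((σ * Equiv.swap a b) ^ m) x = (σ ^ m) x := by
    intro m
    induction m with
    | zero => rfl
    | succ m ih =>
      have ha' : (σ ^ m) x ≠ a := fun h => ha ⟨m, by rw [zpow_natCast, ih, h]⟩
      have hb' : (σ ^ m) x ≠ b := fun h => hb ⟨m, by rw [zpow_natCast, ih, h]⟩
      rw [pow_succ', pow_succ', Equiv.Perm.mul_apply, ih, Equiv.Perm.mul_apply,
        Equiv.swap_apply_of_ne_of_ne ha' hb', Equiv.Perm.mul_apply]
  exact ⟨k, by rw [zpow_natCast, key]⟩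

lemma nc_mul_isSwap_le {α : Type*} [Finite α] [DecidableEq α] (σ : Equiv.Perm α) {τ : Equiv.Perm α}
    (hτ : τ.IsSwap) : nc (σ * τ) ≤ nc σ + 1 := by
  obtain ⟨a, b, -, rfl⟩ := hτ
  let s := MulAction.orbitRel (Subgroup.zpowers σ) α
  let t := MulAction.orbitRel (Subgroup.zpowers (σ * Equiv.swap a b)) α
  let F : Option (Quotient s) → Quotient t := fun o =>
    o.elim (Quotient.mk t a) fun q =>
      if q = Quotient.mk s b then Quotient.mk t b else Quotient.mk t q.out
  have hF : Function.Surjective F := by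
    intro q
    induction q using Quotient.inductionOn with | _ x => ?_
    by_cases ha : (σ * Equiv.swap a b).SameCycle x a
    · exact ⟨none, Quotient.sound ((orbitRel_zpowers_iff_sameCycle _ _ _).2 ha)⟩
    by_cases hb : (σ * Equiv.swap a b).SameCycle x b
    · refine ⟨some (Quotient.mk s b), ?_⟩
      simp only [F, Option.elim_some, if_true]
      exact Quotient.sound ((orbitRel_zpowers_iff_sameCycle _ _ _).2 hb)
    · refine ⟨some (Quotient.mk s x), ?_⟩
      have hne : Quotient.mk s x ≠ Quotient.mk s b := fun h =>
        hb (sameCycle_mul_swap_of_not_sameCycle ha hb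
          ((orbitRel_zpowers_iff_sameCycle _ _ _).1 (Quotient.exact h)).symm)
      simp only [F, Option.elim_some, if_neg hne]
      exact Quotient.sound ((orbitRel_zpowers_iff_sameCycle _ _ _).2
        (sameCycle_mul_swap_of_not_sameCycle ha hb
          ((orbitRel_zpowers_iff_sameCycle _ _ _).1 (Quotient.mk_out (s := s) x))))
  calc nc (σ * Equiv.swap a b) ≤ Nat.card (Option (Quotient s)) :=
        Nat.card_le_card_of_surjective F hF
    _ = nc σ + 1 := Finite.card_option

lemma nc_mul_prod_isSwap_le {α : Type*} [Finite α] [DecidableEq α] (σ : Equiv.Perm α)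
    (l : List (Equiv.Perm α)) (hl : ∀ τ ∈ l, τ.IsSwap) : nc (σ * l.prod) ≤ nc σ + l.length := by
  induction l generalizing σ with
  | nil => simp
  | cons τ l ih =>
    have h₁ := nc_mul_isSwap_le σ (hl τ List.mem_cons_self)
    have h₂ := ih (σ * τ) fun ρ hρ => hl ρ (List.mem_cons_of_mem _ hρ)
    rw [List.prod_cons, ← mul_assoc, List.length_cons]
    omega

lemma nc_le_card {α : Type*} [Finite α] (σ : Equiv.Perm α) : nc σ ≤ Nat.card α :=
  Nat.card_le_card_of_surjective _ Quotient.mk_surjective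

lemma nc_eq_card_iff {α : Type*} [Finite α] (σ : Equiv.Perm α) :
    nc σ = Nat.card α ↔ σ = 1 := by
  have hs : Function.Surjective (Quotient.mk (MulAction.orbitRel (Subgroup.zpowers σ) α)) :=
    Quotient.mk_surjective
  constructor
  · intro h
    have hb := (Nat.bijective_iff_surjective_and_card _).2 ⟨hs, h.symm⟩
    ext x
    refine hb.1 (Quotient.sound ((orbitRel_zpowers_iff_sameCycle _ _ _).2 ⟨1, ?_⟩))
    simp
  · rintro rfl
    refine (Nat.card_eq_of_bijective _ ⟨fun x y h => ?_, hs⟩).symm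
    exact (Equiv.Perm.sameCycle_one.1
      ((orbitRel_zpowers_iff_sameCycle _ _ _).1 (Quotient.exact h))).symm

/-- The endpoint condition for a tuple of transpositions splits off its first entry. -/
lemma isSwap_cons_and_nc_eq_iff {α : Type*} [Finite α] [DecidableEq α] (σ τ : Equiv.Perm α) (k : ℕ)
    (f : Fin k → Equiv.Perm α) :
    ((∀ m, (Fin.cons τ f : Fin (k + 1) → Equiv.Perm α) m |>.IsSwap) ∧
        nc (σ * (τ * (List.ofFn f).prod)) = nc σ + (k + 1)) ↔
      (τ.IsSwap ∧ nc (σ * τ) = nc σ + 1) ∧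
        (∀ m, (f m).IsSwap) ∧ nc (σ * τ * (List.ofFn f).prod) = nc (σ * τ) + k := by
  rw [Fin.forall_fin_succ]
  simp only [Fin.cons_zero, Fin.cons_succ, ← mul_assoc]
  constructor
  · rintro ⟨⟨hτ, hf⟩, h⟩
    have h₁ := nc_mul_isSwap_le σ hτ
    have h₂ := nc_mul_prod_isSwap_le (σ * τ) (List.ofFn f) (by simpa [List.mem_ofFn] using hf)
    rw [List.length_ofFn] at h₂
    exact ⟨⟨hτ, by omega⟩, hf, by omega⟩
  · rintro ⟨⟨hτ, h₁⟩, hf, h₂⟩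
    exact ⟨⟨hτ, hf⟩, by omega⟩

/-- Reversal matches the factorizations of `σ⁻¹` into `k` transpositions with those of `σ`. -/
lemma card_isSwap_prod_eq_inv {α : Type*} [DecidableEq α] (σ : Equiv.Perm α) (k : ℕ) :
    Nat.card {f : Fin k → Equiv.Perm α // (∀ m, (f m).IsSwap) ∧ (List.ofFn f).prod = σ⁻¹} =
      Nat.card {f : Fin k → Equiv.Perm α // (∀ m, (f m).IsSwap) ∧ (List.ofFn f).prod = σ} := by
  refine Nat.card_congr ((Equiv.arrowCongr Fin.revPerm (Equiv.refl _)).subtypeEquiv fun f => ?_)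
  have hswap : (∀ m, (f m).IsSwap) ↔
      ∀ m, (Equiv.arrowCongr Fin.revPerm (Equiv.refl (Equiv.Perm α)) f m).IsSwap := by
    simpa using (Fin.revPerm (n := k)).forall_congr_left
  rw [← hswap]
  refine and_congr_right fun hf => ?_
  have hinv : (List.ofFn f).map (·⁻¹) = List.ofFn f := by
    rw [List.map_ofFn]
    congr 1
    ext1 m
    obtain ⟨a, b, -, h⟩ := hf m
    simp [h]
  have hrev : List.ofFn (Equiv.arrowCongr Fin.revPerm (Equiv.refl (Equiv.Perm α)) f) =
      (List.ofFn f).reverse := by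
    refine List.ext_getElem (by simp) fun m _ _ => ?_
    simp only [List.getElem_ofFn, List.getElem_reverse, List.length_ofFn,
      Equiv.arrowCongr_apply, Function.comp_apply, Equiv.refl_apply, Fin.revPerm_symm,
      Fin.revPerm_apply]
    congr 1
    ext
    simp only [Fin.val_rev]
    omega
  rw [hrev, ← hinv, ← List.prod_inv_reverse, hinv, inv_eq_iff_eq_inv]

/-- The Taylor coefficients at `t = 0` of the normalized moments of the
`n`-dimensional free unitary Brownian motion: the recursion
`P^{σ,0}_{i,j} = δ_{i,j}`, `P^{σ,k}_{i,j} = (1/n) ∑_{τ ∈ T₊(σ)} P^{στ,k-1}_{i∘τ,j}`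
resolves to a sum over `k`-tuples of transpositions lying on a geodesic, and at
`k = d(σ) = p - nc(σ)` it is `n^{-d(σ)} · M(σ) · δ_{i∘σ⁻¹, j}` with `M(σ)` the
number of minimal factorizations of `σ`. -/
theorem stmt17 (n p : ℕ) (hn : 1 ≤ n) (hp : 1 ≤ p)
    (P : Equiv.Perm (Fin p) → ℕ → (Fin p → Fin n) → (Fin p → Fin n) → ℚ)
    (hP0 : ∀ σ (i j : Fin p → Fin n), P σ 0 i j = if i = j then 1 else 0)
    (hPrec : ∀ σ (k : ℕ) (i j : Fin p → Fin n),
      P σ (k + 1) i j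
        = (1 / (n : ℚ)) * ∑ τ ∈ Finset.univ.filter
            (fun τ : Equiv.Perm (Fin p) => τ.IsSwap ∧ nc (σ * τ) = nc σ + 1),
            P (σ * τ) k (i ∘ ⇑τ) j) :
    (∀ (σ : Equiv.Perm (Fin p)) (k : ℕ), 1 ≤ k → ∀ i j : Fin p → Fin n,
      P σ k i j
        = (1 / (n : ℚ) ^ k) *
          ∑ f : Fin k → Equiv.Perm (Fin p),
            if (∀ m, (f m).IsSwap) ∧ nc (σ * (List.ofFn f).prod) = nc σ + k then
              (if i ∘ ⇑((List.ofFn f).prod) = j then (1 : ℚ) else 0)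
            else 0) ∧
    (∀ (σ : Equiv.Perm (Fin p)) (i j : Fin p → Fin n),
      P σ (p - nc σ) i j
        = (1 / (n : ℚ) ^ (p - nc σ)) *
          (Nat.card {f : Fin (p - nc σ) → Equiv.Perm (Fin p) //
              (∀ m, (f m).IsSwap) ∧ (List.ofFn f).prod = σ} : ℚ) *
          (if i ∘ ⇑σ⁻¹ = j then (1 : ℚ) else 0)) := by
  have main : ∀ (k : ℕ) (σ : Equiv.Perm (Fin p)) (i j : Fin p → Fin n),
      P σ k i j
        = (1 / (n : ℚ) ^ k) *
          ∑ f : Fin k → Equiv.Perm (Fin p),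
            if (∀ m, (f m).IsSwap) ∧ nc (σ * (List.ofFn f).prod) = nc σ + k then
              (if i ∘ ⇑((List.ofFn f).prod) = j then (1 : ℚ) else 0)
            else 0 := by
    intro k
    induction k with
    | zero => intro σ i j; simp [hP0]
    | succ k ih =>
      intro σ i j
      rw [hPrec, ← (Fin.consEquiv fun _ => Equiv.Perm (Fin p)).sum_comp, Fintype.sum_prod_type,
        Finset.sum_filter, pow_succ', ← one_div_mul_one_div, mul_assoc,
        Finset.mul_sum (a := 1 / (n : ℚ) ^ k)]
      congr 1
      refine Finset.sum_congr rfl fun τ _ => ?_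
      simp only [Fin.consEquiv_apply, List.ofFn_succ, Fin.cons_zero, Fin.cons_succ,
        List.prod_cons, isSwap_cons_and_nc_eq_iff]
      by_cases h : τ.IsSwap ∧ nc (σ * τ) = nc σ + 1
      · rw [if_pos h, ih]
        simp only [h, true_and, and_self, Equiv.Perm.coe_mul, Function.comp_assoc]
        congr!
      · simp [h]
  refine ⟨fun σ k _ i j => main k σ i j, fun σ i j => ?_⟩
  rw [main, mul_assoc]
  congr 1
  have hle : nc σ ≤ p := by simpa using nc_le_card σ
  have hend : ∀ ρ : Equiv.Perm (Fin p), nc (σ * ρ) = nc σ + (p - nc σ) ↔ ρ = σ⁻¹ := by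
    intro ρ
    rw [Nat.add_sub_cancel' hle, ← mul_eq_one_iff_eq_inv', ← nc_eq_card_iff, Nat.card_fin]
  rw [← card_isSwap_prod_eq_inv, Nat.card_eq_fintype_card, Fintype.card_subtype,
    ← Finset.sum_boole, Finset.sum_mul]
  refine Finset.sum_congr rfl fun f _ => ?_
  simp only [hend]
  by_cases h : (∀ m, (f m).IsSwap) ∧ (List.ofFn f).prod = σ⁻¹
  · rw [if_pos h, if_pos h, h.2, one_mul]
  · rw [if_neg h, if_neg h, zero_mul]
end
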